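/- arXiv:2601.20825 — 7 statements merged into one kernel-verified Lean document; each statement's English description precedes it below -/
import Mathlib

section
/- Plotkin bound: Let C be a q-ary [n,k] linear block code with C ≠ {0} and minimum distance d = d_min(C). If d > n(1 − 1/q), i.e. q·d > (q−1)·n, then |C| ≤ d/(d − n(1−1/q)); equivalently, |C| · (q·d − (q−1)·n) ≤ q·d. -/
/-- A linear functional on a finite space vanishes on at least a `1/q` fraction of it. -/
theorem card_le_card_mul_card_filter_eq_zero {F V : Type*} [Field F] [Fintype F] [DecidableEq F]
    [AddCommGroup V] [Module F V] [Fintype V] (φ : V →ₗ[F] F) :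
    Fintype.card V ≤ Fintype.card F * (Finset.univ.filter fun v => φ v = 0).card := by
  have hker : (Finset.univ.filter fun v => φ v = 0).card = Nat.card (LinearMap.ker φ) := by
    rw [← Fintype.card_subtype, ← Nat.card_eq_fintype_card]
    rfl
  rw [hker, ← Nat.card_eq_fintype_card, ← Nat.card_eq_fintype_card,
    Submodule.card_eq_card_quotient_mul_card (LinearMap.ker φ), mul_comm]
  refine Nat.mul_le_mul_right _ ?_
  rw [Nat.card_congr φ.quotKerEquivRange.toEquiv]
  exact Nat.card_le_card_of_injective _ Subtype.val_injective

/-- The total weight of a linear code is at most `(q - 1) / q * n * |C|`. -/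
theorem card_mul_sum_hammingNorm_le {F : Type*} [Field F] [Fintype F] [DecidableEq F] {n : ℕ}
    (C : Submodule F (Fin n → F)) [Fintype C] :
    Fintype.card F * ∑ c : C, hammingNorm (c : Fin n → F) ≤
      (Fintype.card F - 1) * n * Fintype.card C := by
  have hcoord (i : Fin n) :
      Fintype.card F * (Finset.univ.filter fun c : C => (c : Fin n → F) i ≠ 0).card ≤
        (Fintype.card F - 1) * Fintype.card C := by
    have hzero : Fintype.card C ≤
        Fintype.card F * (Finset.univ.filter fun c : C => (c : Fin n → F) i = 0).card :=
      card_le_card_mul_card_filter_eq_zero ((LinearMap.proj i).comp C.subtype)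
    have hsplit := Finset.card_filter_add_card_filter_not (s := (Finset.univ : Finset C))
      (fun c : C => (c : Fin n → F) i = 0)
    rw [Finset.card_univ] at hsplit
    rw [Nat.sub_mul, one_mul]
    apply Nat.le_sub_of_add_le
    calc _ ≤ _ := Nat.add_le_add_left hzero _
      _ = _ := by rw [← mul_add, add_comm, ← hsplit]
  have hswap : ∑ c : C, hammingNorm (c : Fin n → F) =
      ∑ i, (Finset.univ.filter fun c : C => (c : Fin n → F) i ≠ 0).card := by
    simp only [hammingNorm, Finset.card_filter]
    exact Finset.sum_comm
  rw [hswap, Finset.mul_sum]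
  refine (Finset.sum_le_sum fun i _ => hcoord i).trans_eq ?_
  simp only [Finset.sum_const, Finset.card_univ, Fintype.card_fin, smul_eq_mul]
  ring

/-- If every nonzero codeword has weight at least `d`, the total weight is at least
`(|C| - 1) * d`. -/
theorem card_mul_le_sum_hammingNorm_add {F : Type*} [Field F] [DecidableEq F] {n d : ℕ}
    (C : Submodule F (Fin n → F)) [Fintype C] (hd : ∀ c ∈ C, c ≠ 0 → d ≤ hammingNorm c) :
    Fintype.card C * d ≤ ∑ c : C, hammingNorm (c : Fin n → F) + d := by
  classical
  calc Fintype.card C * d = ∑ _c : C, d := by simp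
    _ ≤ ∑ c : C, (hammingNorm (c : Fin n → F) + if c = 0 then d else 0) := by
        refine Finset.sum_le_sum fun c _ => ?_
        split_ifs with h
        · exact Nat.le_add_left _ _
        · exact hd c c.2 (by simpa using h)
    _ = _ := by simp [Finset.sum_add_distrib]


/-- **Plotkin bound.** Let `C` be a `q`-ary `[n,k]` linear block code with `C ≠ {0}` and
minimum distance `d = d_min(C)`. If `q·d > (q−1)·n` then `|C| · (q·d − (q−1)·n) ≤ q·d`. -/
theorem stmt_0 {F : Type*} [Field F] [Fintype F] [DecidableEq F]
    (q n k : ℕ) (hq : Fintype.card F = q)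
    (C : Submodule F (Fin n → F)) (hk : Module.finrank F C = k)
    (hC : C ≠ ⊥)
    (d : ℕ) (hd : d = sInf {w : ℕ | ∃ c ∈ C, c ≠ 0 ∧ w = hammingNorm c})
    (hgt : (q - 1) * n < q * d) :
    Nat.card C * (q * d - (q - 1) * n) ≤ q * d := by
  subst hq
  have := Fintype.ofFinite C
  have hmin : ∀ c ∈ C, c ≠ 0 → d ≤ hammingNorm c := fun c hc h0 =>
    hd ▸ Nat.sInf_le ⟨c, hc, h0, rfl⟩
  have hupper := card_mul_sum_hammingNorm_le C
  have hlower := Nat.mul_le_mul_left (Fintype.card F) (card_mul_le_sum_hammingNorm_add C hmin)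
  rw [Nat.card_eq_fintype_card, Nat.mul_sub, Nat.sub_le_iff_le_add]
  linarith
end

section
/- Weight distribution of MacDonald codes: Let 1 ≤ k ≤ m−1 and let C_{m,m−k}(q) ∈ F_q^{m × (q^m−q^{m−k})/(q−1)} be obtained from a generator matrix S(q,m) of the q-ary simplex code of dimension m by deleting exactly those (q^{m−k}−1)/(q−1) columns whose first k entries are all zero. Then for every nonzero u ∈ F_q^m: if u_i = 0 for all i > k (so that u·C_{m,m−k}(q) is a nonzero linear combination of the first k rows), then wt(u·C_{m,m−k}(q)) = q^{m−1}; otherwise wt(u·C_{m,m−k}(q)) = q^{m−1} − q^{m−k−1}. -/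
open Module

/-- Number of vectors outside the kernel of a nonzero linear functional over a finite field. -/
theorem card_filter_dual_ne_zero {F V : Type*} [Field F] [Fintype F] [DecidableEq F]
    [AddCommGroup V] [Module F V] [Fintype V] (f : Dual F V) (hf : f ≠ 0) :
    (Finset.univ.filter fun v : V => f v ≠ 0).card =
      (Fintype.card F - 1) * Fintype.card F ^ (finrank F V - 1) := by
  classical
  have hker : (Finset.univ.filter fun v : V => f v = 0).card =
      Fintype.card F ^ (finrank F V - 1) := by
    rw [← Dual.finrank_ker_add_one_of_ne_zero hf, Nat.add_sub_cancel,
      ← card_eq_pow_finrank (K := F) (V := LinearMap.ker f), ← Fintype.card_subtype]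
    exact Fintype.card_congr (Equiv.refl _)
  have hsum := Finset.card_filter_add_card_filter_not (s := (Finset.univ : Finset V))
    (fun v => f v = 0)
  rw [hker, Finset.card_univ, card_eq_pow_finrank (K := F) (V := V),
    ← Dual.finrank_ker_add_one_of_ne_zero hf, Nat.add_sub_cancel, pow_succ'] at hsum
  rw [← Dual.finrank_ker_add_one_of_ne_zero hf, Nat.add_sub_cancel, Nat.sub_mul, one_mul]
  exact Nat.eq_sub_of_add_eq' hsum

/-- Pairwise non-proportional nonzero vectors, as many as there are lines in the space, meet
every line exactly once: a scaling-invariant predicate failing at zero holds for `q - 1` times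
as many vectors as representatives. -/
theorem card_filter_eq_mul_of_line_representatives {F V ι : Type*} [Field F] [Fintype F]
    [AddCommGroup V] [Module F V] [Fintype V] [Fintype ι] (s : ι → V)
    (hs : ∀ j, s j ≠ 0) (hinj : ∀ j j', j ≠ j' → ∀ c : F, s j' ≠ c • s j)
    (hcard : Fintype.card ι * (Fintype.card F - 1) = Fintype.card V - 1)
    (P : V → Prop) [DecidablePred P] (hP0 : ¬ P 0)
    (hP : ∀ (c : Fˣ) (v : V), P (c • v) ↔ P v) :
    (Finset.univ.filter P).card =
      (Finset.univ.filter fun j => P (s j)).card * (Fintype.card F - 1) := by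
  classical
  let g : ι × Fˣ → {v : V // v ≠ 0} := fun x =>
    ⟨x.2 • s x.1, by rw [Ne, smul_eq_zero_iff_eq]; exact hs x.1⟩
  have hg : Function.Injective g := by
    rintro ⟨j, c⟩ ⟨j', c'⟩ h
    have h : c • s j = c' • s j' := congrArg Subtype.val h
    obtain rfl : j = j' := by
      by_contra hne
      apply hinj j j' hne ((c'⁻¹ * c : Fˣ) : F)
      change s j' = (c'⁻¹ * c) • s j
      rw [mul_smul, h, inv_smul_smul]
    have hc : (c : F) = c' := smul_left_injective F (hs j) h
    rw [Units.ext hc]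
  have hbij : Function.Bijective g := by
    rw [Fintype.bijective_iff_injective_and_card]
    refine ⟨hg, ?_⟩
    rw [Fintype.card_prod, Fintype.card_units, hcard, Fintype.card_subtype_compl,
      Fintype.card_subtype_eq]
  rw [← Fintype.card_units, ← Finset.card_univ (α := Fˣ), ← Finset.card_product]
  symm
  refine Finset.card_bij (fun x _ => (g x : V)) ?_ ?_ ?_
  · rintro ⟨j, c⟩ hx
    simpa [g, hP] using hx
  · intro x _ y _ h
    exact hg (Subtype.ext h)
  · intro v hv
    have hv : P v := by simpa using hv
    obtain ⟨⟨j, c⟩, hx⟩ := hbij.2 ⟨v, fun h => hP0 (h ▸ hv)⟩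
    have hx : c • s j = v := congrArg Subtype.val hx
    refine ⟨(j, c), ?_, hx⟩
    simpa [← hx, hP] using hv

/-- The vectors whose first `k` coordinates vanish form a space of dimension `m - k`. -/
theorem finrank_ker_funLeft_castLE {F : Type*} [Field F] {m k : ℕ} (h : k ≤ m) :
    finrank F (LinearMap.ker (LinearMap.funLeft F F (Fin.castLE h))) = m - k := by
  have hsurj := LinearMap.funLeft_surjective_of_injective F F _ (Fin.castLE_injective h)
  have hrank := LinearMap.finrank_range_add_finrank_ker (LinearMap.funLeft F F (Fin.castLE h))
  rw [LinearMap.range_eq_top.2 hsurj, finrank_top, finrank_fin_fun, finrank_fin_fun] at hrank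
  omega


/-- **Weight distribution of MacDonald codes.** Let `1 ≤ k ≤ m−1` and let the MacDonald code
be obtained from a generator matrix `S(q,m)` of the `q`-ary simplex code of dimension `m`
by deleting exactly those columns whose first `k` entries are all zero. Then every nonzero
codeword obtained as a linear combination of the first `k` rows has weight `q^{m−1}`, and
every other nonzero codeword has weight `q^{m−1} − q^{m−k−1}`. -/
theorem stmt_5 {F : Type*} [Field F] [Fintype F] [DecidableEq F]
    (q m k N : ℕ) (hq : Fintype.card F = q) (hk1 : 1 ≤ k) (hk2 : k ≤ m - 1)
    (hN : N * (q - 1) = q ^ m - 1)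
    (S : Matrix (Fin m) (Fin N) F)
    (hS1 : ∀ j, (fun i => S i j) ≠ 0)
    (hS2 : ∀ j j', j ≠ j' → ∀ c : F, (fun i => S i j') ≠ c • fun i => S i j)
    (u : Fin m → F) (hu : u ≠ 0) :
    ((∀ i : Fin m, k ≤ (i : ℕ) → u i = 0) →
      (Finset.univ.filter fun j : Fin N =>
          (∃ i : Fin m, (i : ℕ) < k ∧ S i j ≠ 0) ∧ Matrix.vecMul u S j ≠ 0).card
        = q ^ (m - 1)) ∧
    ((¬ ∀ i : Fin m, k ≤ (i : ℕ) → u i = 0) →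
      (Finset.univ.filter fun j : Fin N =>
          (∃ i : Fin m, (i : ℕ) < k ∧ S i j ≠ 0) ∧ Matrix.vecMul u S j ≠ 0).card
        = q ^ (m - 1) - q ^ (m - k - 1)) := by
  classical
  subst hq
  have hkm : k ≤ m := by omega
  have hq1 : 0 < Fintype.card F - 1 := Nat.sub_pos_of_lt Fintype.one_lt_card
  let f : Dual F (Fin m → F) := dotProductBilin F F u
  let W := LinearMap.ker (LinearMap.funLeft F F (Fin.castLE hkm))
  have hf (v : Fin m → F) : f v = u ⬝ᵥ v := rfl
  have hW (v : Fin m → F) : v ∉ W ↔ ∃ i : Fin m, (i : ℕ) < k ∧ v i ≠ 0 := by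
    rw [LinearMap.mem_ker, funext_iff, not_forall]
    constructor
    · rintro ⟨i, hi⟩
      exact ⟨Fin.castLE hkm i, i.2, hi⟩
    · rintro ⟨i, hik, hi⟩
      exact ⟨⟨i, hik⟩, hi⟩
  have hf0 : f ≠ 0 := by
    intro h
    refine hu (dotProduct_eq_zero u fun v => ?_)
    rw [← hf, h, LinearMap.zero_apply]
  have hrestrict : f.domRestrict W = 0 ↔ ∀ i : Fin m, k ≤ (i : ℕ) → u i = 0 := by
    constructor
    · intro h i hi
      have hmem : Pi.single i 1 ∈ W := by
        by_contra hn
        obtain ⟨i', hi', hne⟩ := (hW _).1 hn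
        exact hne (Pi.single_eq_of_ne (by rintro rfl; omega) 1)
      have := LinearMap.congr_fun h ⟨_, hmem⟩
      simpa [hf] using this
    · intro h
      ext ⟨v, hv⟩
      change u ⬝ᵥ v = 0
      refine Finset.sum_eq_zero fun i _ => ?_
      by_cases hi : k ≤ (i : ℕ)
      · rw [h i hi, zero_mul]
      · have : v i = 0 := by
          by_contra hne
          exact (hW v).2 ⟨i, by omega, hne⟩ hv
        rw [this, mul_zero]
  have hcount := card_filter_eq_mul_of_line_representatives (F := F) (fun j i => S i j) hS1 hS2
    (by simpa using hN) (fun v => v ∉ W ∧ f v ≠ 0) (by simp)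
    (by
      intro c v
      have hc : f (c • v) = (c : F) * f v := f.map_smul (c : F) v
      have hcW : c • v ∈ W ↔ v ∈ W := W.smul_mem_iff (x := v) c.ne_zero
      simp [hc, hcW])
  have hsplit : (Finset.univ.filter fun v => v ∉ W ∧ f v ≠ 0).card +
      (Finset.univ.filter fun w : W => f.domRestrict W w ≠ 0).card =
        (Finset.univ.filter fun v => f v ≠ 0).card := by
    have himage : (Finset.univ.filter fun w : W => f.domRestrict W w ≠ 0).card =
        (Finset.univ.filter fun v => v ∈ W ∧ f v ≠ 0).card := by
      rw [← Finset.card_map (Function.Embedding.subtype (· ∈ W))]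
      congr 1
      ext v
      rw [Finset.mem_map, Finset.mem_filter_univ]
      constructor
      · rintro ⟨w, hw, rfl⟩
        exact ⟨w.2, (Finset.mem_filter.1 hw).2⟩
      · rintro ⟨hv, hfv⟩
        exact ⟨⟨v, hv⟩, Finset.mem_filter.2 ⟨Finset.mem_univ _, hfv⟩, rfl⟩
    rw [himage, ← Finset.card_filter_add_card_filter_not (s := Finset.univ.filter fun v => f v ≠ 0)
      (fun v => v ∈ W), Finset.filter_filter, Finset.filter_filter, add_comm]
    simp only [and_comm]
  rw [card_filter_dual_ne_zero f hf0, finrank_fin_fun, hcount] at hsplit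
  simp only [hW] at hsplit
  change (Finset.univ.filter fun j : Fin N =>
    (∃ i : Fin m, (i : ℕ) < k ∧ S i j ≠ 0) ∧ Matrix.vecMul u S j ≠ 0).card * _ + _ = _ at hsplit
  rw [← hrestrict]
  constructor
  · intro h
    simp only [h, LinearMap.zero_apply, ne_eq, not_true_eq_false, Finset.filter_false,
      Finset.card_empty, add_zero] at hsplit
    rw [mul_comm] at hsplit
    exact Nat.eq_of_mul_eq_mul_left hq1 hsplit
  · intro h
    rw [card_filter_dual_ne_zero _ h, finrank_ker_funLeft_castLE hkm, mul_comm, ← mul_add] at hsplit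
    exact Nat.eq_sub_of_add_eq (Nat.eq_of_mul_eq_mul_left hq1 hsplit)
end

section
/- Singleton-like bound for column distances: Let C be a delay-free (n,k,δ) convolutional code over F_q with k ≤ n. Then for every j ∈ ℕ0, d_j^c(C) ≤ (n−k)(j+1) + 1. Moreover, if d_j^c(C) = (n−k)(j+1) + 1 for some j ∈ ℕ0, then d_i^c(C) = (n−k)(i+1) + 1 for all i ≤ j. -/
open Finset Polynomial Matrix

noncomputable section

variable {F : Type*} [Field F] [DecidableEq F]

/-- The coefficient vector at time `t` of a polynomial vector `v(z)`. -/
def coeffVec {ι : Type*} (v : ι → Polynomial F) (t : ℕ) : ι → F := fun i => (v i).coeff t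

/-- `G(z)` is a generator matrix of the convolutional code `C`:
its rows form a basis of `C`. -/
def IsGenMat {ι : Type*} {k : ℕ} (C : Submodule (Polynomial F) (ι → Polynomial F))
    (G : Matrix (Fin k) ι (Polynomial F)) : Prop :=
  LinearIndependent (Polynomial F) (fun i => G i) ∧
    Submodule.span (Polynomial F) (Set.range fun i => G i) = C

/-- The `j`-th column distance of a convolutional code. -/
def colDist {ι : Type*} [Fintype ι] (C : Submodule (Polynomial F) (ι → Polynomial F))
    (j : ℕ) : ℕ :=
  sInf { d : ℕ | ∃ v ∈ C, coeffVec v 0 ≠ 0 ∧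
      d = ∑ t ∈ Finset.range (j + 1), hammingNorm (coeffVec v t) }

/-- The free distance of a convolutional code. -/
def freeDist {ι : Type*} [Fintype ι] (C : Submodule (Polynomial F) (ι → Polynomial F)) : ℕ :=
  sInf { d : ℕ | ∃ v ∈ C, v ≠ 0 ∧ d = ∑ᶠ t : ℕ, hammingNorm (coeffVec v t) }

/-- External degree of a polynomial matrix: the sum of its row degrees. -/
def extDeg {ι : Type*} [Fintype ι] {k : ℕ} (G : Matrix (Fin k) ι (Polynomial F)) : ℕ :=
  ∑ i : Fin k, Finset.univ.sup fun j : ι => (G i j).natDegree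

/-- Internal degree of a polynomial matrix: the maximal degree of its `k×k` minors. -/
def intDeg {ι : Type*} [Fintype ι] [DecidableEq ι] {k : ℕ}
    (G : Matrix (Fin k) ι (Polynomial F)) : ℕ :=
  Finset.univ.sup fun f : Fin k ↪ ι => ((G.submatrix id fun i => f i).det).natDegree

/-- `C` is an `(n,k,δ)` convolutional code: it has a row-reduced generator matrix
(with `k` rows, internal degree = external degree) of external degree `δ`. -/
def HasParams {ι : Type*} [Fintype ι] [DecidableEq ι] (k δ : ℕ)
    (C : Submodule (Polynomial F) (ι → Polynomial F)) : Prop :=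
  ∃ G : Matrix (Fin k) ι (Polynomial F), IsGenMat C G ∧ intDeg G = extDeg G ∧ extDeg G = δ

/-- `C` is delay-free: some generator matrix `G(z)` has `G(0)` of full row rank `k`. -/
def IsDelayFree {ι : Type*} [Fintype ι] (k : ℕ)
    (C : Submodule (Polynomial F) (ι → Polynomial F)) : Prop :=
  ∃ G : Matrix (Fin k) ι (Polynomial F), IsGenMat C G ∧ (G.map fun p => p.coeff 0).rank = k

/-- `C` is non-catastrophic: it admits a full-rank parity-check matrix. -/
def IsNoncatastrophic {ι : Type*} [Fintype ι] (k : ℕ)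
    (C : Submodule (Polynomial F) (ι → Polynomial F)) : Prop :=
  ∃ H : Matrix (Fin (Fintype.card ι - k)) ι (Polynomial F),
    LinearIndependent (Polynomial F) (fun i => H i) ∧ ∀ v, v ∈ C ↔ H.mulVec v = 0

/-- A matrix of full row rank has an information set: `k` columns on which every vector of
length `k` is attained by a combination of the rows. -/
lemma exists_information_set {K : Type*} [Field K] {n k : ℕ}
    (A : Matrix (Fin k) (Fin n) K) (hA : A.rank = k) :
    ∃ g : Fin k → Fin n, Function.Injective g ∧
      ∀ y : Fin k → K, ∃ u : Fin k → K, ∀ i, (u ᵥ* A) (g i) = y i := by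
  obtain ⟨f, hf, -, hli⟩ :=
    Submodule.exists_fun_fin_finrank_span_eq K (Set.range A.col)
  rw [Matrix.rank_eq_finrank_span_cols] at hA
  choose g hg using hf
  have hB : LinearIndependent K (fun i : Fin k => A.col (g (Fin.cast hA.symm i))) := by
    simp only [hg]
    exact hli.comp _ (Fin.cast_injective _)
  refine ⟨fun i => g (Fin.cast hA.symm i), fun a b hab => hB.injective ?_, fun y => ?_⟩
  · exact congrArg A.col hab
  · have hu : IsUnit (A.submatrix id fun i => g (Fin.cast hA.symm i)) :=
      Matrix.linearIndependent_cols_iff_isUnit.mp hB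
    rw [Matrix.isUnit_iff_isUnit_det] at hu
    refine ⟨y ᵥ* (A.submatrix id fun i => g (Fin.cast hA.symm i))⁻¹, fun i => ?_⟩
    have h : y ᵥ* (A.submatrix id fun i => g (Fin.cast hA.symm i))⁻¹ ᵥ*
        (A.submatrix id fun i => g (Fin.cast hA.symm i)) = y := by
      rw [Matrix.vecMul_vecMul, Matrix.nonsing_inv_mul _ hu, Matrix.vecMul_one]
    exact congrFun h i

/-- The weight of a vector is at most the weight of its restriction to `k` coordinates plus the
number of remaining coordinates. -/
lemma hammingNorm_le_add_comp {n k : ℕ} {g : Fin k → Fin n} (hg : Function.Injective g)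
    (x : Fin n → F) : hammingNorm x ≤ (n - k) + hammingNorm (x ∘ g) := by
  have hsub : ({i | x i ≠ 0} : Finset (Fin n)) ⊆
      (univ.image g)ᶜ ∪ ({i | (x ∘ g) i ≠ 0} : Finset (Fin k)).image g := by
    intro i hi
    simp only [mem_filter, mem_union, mem_compl, mem_image, mem_univ, true_and] at hi ⊢
    by_cases h : ∃ a, g a = i
    · obtain ⟨a, rfl⟩ := h
      exact Or.inr ⟨a, hi, rfl⟩
    · exact Or.inl h
  refine (card_le_card hsub).trans ((card_union_le _ _).trans ?_)
  refine add_le_add (le_of_eq ?_) card_image_le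
  rw [card_compl, card_image_of_injective _ hg, card_univ, Fintype.card_fin, Fintype.card_fin]

/-- Constant combinations of the rows of a generator matrix are codewords, with constant term
given by the constant term of the matrix. -/
lemma IsGenMat.exists_mem_coeffVec_zero {K : Type*} [Field K] {n k : ℕ}
    {C : Submodule (Polynomial K) (Fin n → Polynomial K)}
    {G : Matrix (Fin k) (Fin n) (Polynomial K)} (hG : IsGenMat C G) (u : Fin k → K) :
    ∃ v ∈ C, coeffVec v 0 = u ᵥ* (G.map fun p => p.coeff 0) := by
  refine ⟨∑ i, Polynomial.C (u i) • G i, ?_, ?_⟩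
  · rw [← hG.2]
    exact Submodule.sum_mem _ fun i _ =>
      Submodule.smul_mem _ _ (Submodule.subset_span ⟨i, rfl⟩)
  · ext m
    simp [coeffVec, Matrix.vecMul, dotProduct, Finset.sum_apply]

lemma colDist_le {n : ℕ} {C : Submodule (Polynomial F) (Fin n → Polynomial F)}
    {v : Fin n → Polynomial F} (hv : v ∈ C) (hv0 : coeffVec v 0 ≠ 0) (j : ℕ) :
    colDist C j ≤ ∑ t ∈ range (j + 1), hammingNorm (coeffVec v t) :=
  Nat.sInf_le ⟨v, hv, hv0, rfl⟩

lemma exists_colDist_eq {n : ℕ} {C : Submodule (Polynomial F) (Fin n → Polynomial F)}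
    (hC : ∃ v ∈ C, coeffVec v 0 ≠ 0) (j : ℕ) :
    ∃ v ∈ C, coeffVec v 0 ≠ 0 ∧
      colDist C j = ∑ t ∈ range (j + 1), hammingNorm (coeffVec v t) := by
  obtain ⟨v, hv, hv0⟩ := hC
  exact Nat.sInf_mem (s := { d : ℕ | ∃ v ∈ C, coeffVec v 0 ≠ 0 ∧
      d = ∑ t ∈ Finset.range (j + 1), hammingNorm (coeffVec v t) }) ⟨_, v, hv, hv0, rfl⟩

lemma IsDelayFree.exists_coeffVec_zero_ne_zero {n k : ℕ}
    {C : Submodule (Polynomial F) (Fin n → Polynomial F)} (hC : IsDelayFree k C) (hk : 0 < k) :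
    ∃ v ∈ C, coeffVec v 0 ≠ 0 ∧ hammingNorm (coeffVec v 0) ≤ (n - k) + 1 := by
  obtain ⟨G, hG, hrank⟩ := hC
  obtain ⟨g, hg, hsolve⟩ := exists_information_set _ hrank
  obtain ⟨u, hu⟩ := hsolve (Pi.single ⟨0, hk⟩ 1)
  obtain ⟨v, hv, hv0⟩ := hG.exists_mem_coeffVec_zero u
  rw [← hv0] at hu
  refine ⟨v, hv, fun h => ?_, (hammingNorm_le_add_comp hg _).trans ?_⟩
  · have := hu ⟨0, hk⟩
    simp [h] at this
  · have hcomp : coeffVec v 0 ∘ g = Pi.single ⟨0, hk⟩ 1 := funext hu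
    rw [hcomp]
    refine Nat.add_le_add_left ?_ _
    refine (card_le_card (t := {⟨0, hk⟩}) fun i hi => ?_).trans (card_singleton _).le
    by_contra hne
    rw [mem_singleton] at hne
    simp [Pi.single_eq_of_ne hne] at hi

/-- A codeword can be changed from time `s` on so that its coefficient at time `s` has weight at
most `n - k`. -/
lemma IsDelayFree.exists_modify {n k : ℕ}
    {C : Submodule (Polynomial F) (Fin n → Polynomial F)} (hC : IsDelayFree k C)
    {v : Fin n → Polynomial F} (hv : v ∈ C) (s : ℕ) :
    ∃ w ∈ C, (∀ t < s, coeffVec w t = coeffVec v t) ∧ hammingNorm (coeffVec w s) ≤ n - k := by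
  obtain ⟨G, hG, hrank⟩ := hC
  obtain ⟨g, hg, hsolve⟩ := exists_information_set _ hrank
  obtain ⟨u, hu⟩ := hsolve (coeffVec v s ∘ g)
  obtain ⟨c, hc, hc0⟩ := hG.exists_mem_coeffVec_zero u
  rw [← hc0] at hu
  refine ⟨v - (X ^ s : Polynomial F) • c, C.sub_mem hv (C.smul_mem _ hc), fun t ht => ?_, ?_⟩
  · ext m
    simp [coeffVec, coeff_X_pow_mul', ht.not_ge]
  · refine (hammingNorm_le_add_comp hg _).trans (le_of_eq ?_)
    rw [Nat.add_eq_left, hammingNorm_eq_zero]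
    ext i
    have := hu i
    simp only [coeffVec, Function.comp_apply] at this
    simp [coeffVec, coeff_X_pow_mul', this]

lemma IsDelayFree.colDist_succ_le {n k : ℕ}
    {C : Submodule (Polynomial F) (Fin n → Polynomial F)} (hC : IsDelayFree k C) (hk : 0 < k)
    (j : ℕ) : colDist C (j + 1) ≤ colDist C j + (n - k) := by
  obtain ⟨v₀, hv₀, hne, -⟩ := hC.exists_coeffVec_zero_ne_zero hk
  obtain ⟨v, hv, hv0, hd⟩ := exists_colDist_eq ⟨v₀, hv₀, hne⟩ j
  obtain ⟨w, hw, hwv, hwt⟩ := hC.exists_modify hv (j + 1)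
  refine (colDist_le hw (by rwa [hwv 0 j.succ_pos]) (j + 1)).trans ?_
  rw [sum_range_succ, hd]
  refine add_le_add (le_of_eq (sum_congr rfl fun t ht => ?_)) hwt
  rw [hwv t (mem_range.mp ht)]

lemma IsDelayFree.colDist_add_le {n k : ℕ}
    {C : Submodule (Polynomial F) (Fin n → Polynomial F)} (hC : IsDelayFree k C) (hk : 0 < k)
    (i m : ℕ) : colDist C (i + m) ≤ colDist C i + (n - k) * m := by
  induction m with
  | zero => simp
  | succ m ih =>
    have := hC.colDist_succ_le hk (i + m)
    rw [← add_assoc, mul_add_one]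
    omega

lemma IsGenMat.colDist_eq_zero {n : ℕ} {C : Submodule (Polynomial F) (Fin n → Polynomial F)}
    {G : Matrix (Fin 0) (Fin n) (Polynomial F)} (hG : IsGenMat C G) (j : ℕ) :
    colDist C j = 0 := by
  have hbot : C = ⊥ := by rw [← hG.2, Set.range_eq_empty, Submodule.span_empty]
  refine Nat.sInf_eq_zero.mpr (Or.inr (Set.eq_empty_of_forall_notMem ?_))
  rintro d ⟨v, hv, hv0, -⟩
  rw [hbot, Submodule.mem_bot] at hv
  exact hv0 (by ext; simp [hv, coeffVec])

/-- **Singleton-like bound for column distances.** For a delay-free `(n,k,δ)` convolutional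
code `C` over `F_q` with `k ≤ n`: `d_j^c(C) ≤ (n−k)(j+1)+1` for every `j`, and if equality
holds for some `j` then it holds for all `i ≤ j`. -/
theorem stmt_6 (n k δ : ℕ) (hkn : k ≤ n)
    (C : Submodule (Polynomial F) (Fin n → Polynomial F))
    (hdeg : HasParams k δ C)
    (hdf : IsDelayFree k C) :
    (∀ j : ℕ, colDist C j ≤ (n - k) * (j + 1) + 1) ∧
    ∀ j : ℕ, colDist C j = (n - k) * (j + 1) + 1 →
      ∀ i ≤ j, colDist C i = (n - k) * (i + 1) + 1 := by
  rcases Nat.eq_zero_or_pos k with rfl | hk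
  · obtain ⟨G, hG, -⟩ := hdeg
    simp [hG.colDist_eq_zero]
  have hbound : ∀ j : ℕ, colDist C j ≤ (n - k) * (j + 1) + 1 := by
    intro j
    obtain ⟨v, hv, hv0, hwt⟩ := hdf.exists_coeffVec_zero_ne_zero hk
    have hzero := colDist_le hv hv0 0
    have hadd := hdf.colDist_add_le hk 0 j
    rw [zero_add, sum_range_one] at hzero
    rw [zero_add] at hadd
    rw [mul_add_one]
    omega
  refine ⟨hbound, fun j hj i hij => (hbound i).antisymm ?_⟩
  obtain ⟨m, rfl⟩ := Nat.exists_eq_add_of_le hij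
  have hadd := hdf.colDist_add_le hk i m
  rw [hj] at hadd
  linarith [show (n - k) * (i + m + 1) = (n - k) * (i + 1) + (n - k) * m by ring]
end
end

section
/- Construction 1 (column distances and free distance): Let q be a prime power, k, δ ≥ 1 integers, n = q^δ(q^k−1)/(q−1) and μ = ⌈δ/k⌉. Let G(z) = ∑_{i=0}^{μ} G_i z^i ∈ F_q[z]^{k×n} be such that G_μ has exactly kμ−δ zero rows and the (δ+k)×n matrix obtained by stacking G_0, G_1, …, G_{μ−1} and the δ+k−kμ nonzero rows of G_μ equals a block matrix whose top k rows consist of q^δ copies of a generator matrix S(q,k) of the q-ary simplex code of dimension k placed side by side, and whose bottom δ rows consist of blocks X_1, …, X_{q^δ} ∈ F_q^{δ × (q^k−1)/(q−1)}, where all columns of X_i equal x_i and x_1, …, x_{q^δ} is an enumeration of all vectors of F_q^δ. Then the convolutional code C generated by the rows of G(z) is a non-catastrophic (n,k,δ) convolutional code with column distances d_j^c(C) = q^{δ+k−1} + min(j, ⌊δ/k⌋)·(q^{δ+k−1} − q^{δ−1}) for all j ∈ ℕ0, and free distance d_free(C) = q^{δ+k−1} + ⌊δ/k⌋·(q^{δ+k−1}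 − q^{δ−1}). -/
open Finset Polynomial Matrix

noncomputable section

variable {F : Type*} [Field F] [DecidableEq F]

/-- `padded x t` is `x t` if `t < δ` and `0` otherwise. -/
def padded {δ : ℕ} (x : Fin δ → F) (t : ℕ) : F :=
  if h : t < δ then x ⟨t, h⟩ else 0

set_option linter.unusedSectionVars false

section DetDegree

variable {R n : Type*} [CommRing R]

theorem coeff_prod_sum_of_natDegree_le (s : Finset n) (f : n → R[X]) (d : n → ℕ)
    (h : ∀ i ∈ s, (f i).natDegree ≤ d i) :
    (∏ i ∈ s, f i).coeff (∑ i ∈ s, d i) = ∏ i ∈ s, (f i).coeff (d i) := by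
  classical
  induction s using Finset.induction_on with
  | empty => simp
  | insert a s ha ih =>
    rw [Finset.prod_insert ha, Finset.prod_insert ha, Finset.sum_insert ha,
      ← ih fun i hi => h i (Finset.mem_insert_of_mem hi)]
    refine coeff_mul_add_eq_of_natDegree_le (h a (Finset.mem_insert_self a s)) ?_
    exact (natDegree_prod_le _ _).trans
      (Finset.sum_le_sum fun i hi => h i (Finset.mem_insert_of_mem hi))

variable [Fintype n] [DecidableEq n]

theorem natDegree_det_le_sum (M : Matrix n n R[X]) (d : n → ℕ)
    (h : ∀ i j, (M i j).natDegree ≤ d i) : M.det.natDegree ≤ ∑ i, d i := by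
  rw [Matrix.det_apply]
  refine natDegree_sum_le_of_forall_le _ _ fun σ _ => ?_
  refine (natDegree_smul_le _ _).trans ((natDegree_prod_le _ _).trans ?_)
  rw [← Equiv.sum_comp σ d]
  exact Finset.sum_le_sum fun i _ => h _ _

theorem coeff_det_sum_of_natDegree_le (M : Matrix n n R[X]) (d : n → ℕ)
    (h : ∀ i j, (M i j).natDegree ≤ d i) :
    M.det.coeff (∑ i, d i) = (Matrix.of fun i j => (M i j).coeff (d i)).det := by
  rw [Matrix.det_apply, Matrix.det_apply, finsetSum_coeff]
  refine Finset.sum_congr rfl fun σ _ => ?_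
  rw [coeff_smul, ← Equiv.sum_comp σ d,
    coeff_prod_sum_of_natDegree_le _ (fun i => M (σ i) i) (fun i => d (σ i)) fun i _ => h _ _]
  rfl

end DetDegree

section Counting

variable [Fintype F]

/-- All fibres of a nonzero linear functional on `F^d` have the same size. -/
theorem card_dotProduct_eq {d : ℕ} (w : Fin d → F) (hw : w ≠ 0) (s : F) :
    #{y : Fin d → F | w ⬝ᵥ y = s} = Fintype.card F ^ (d - 1) := by
  obtain ⟨p, hp⟩ := Function.ne_iff.mp hw
  have hp : w p ≠ 0 := hp
  have hfib : ∀ s', #{y : Fin d → F | w ⬝ᵥ y = s'} = #{y : Fin d → F | w ⬝ᵥ y = s} := by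
    intro s'
    refine Finset.card_bij' (fun y _ => y + Pi.single p ((s - s') / w p))
      (fun y _ => y - Pi.single p ((s - s') / w p)) ?_ ?_ ?_ ?_
    · intro y hy
      simp only [Finset.mem_filter, Finset.mem_univ, true_and] at hy ⊢
      rw [dotProduct_add, dotProduct_single, hy]
      field_simp
      ring
    · intro y hy
      simp only [Finset.mem_filter, Finset.mem_univ, true_and] at hy ⊢
      rw [dotProduct_sub, dotProduct_single, hy]
      field_simp
      ring
    · intros; simp
    · intros; simp
  have htot := Finset.card_eq_sum_card_fiberwise (f := fun y : Fin d → F => w ⬝ᵥ y)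
    (s := Finset.univ) (t := Finset.univ) (fun _ _ => Finset.mem_coe.2 (Finset.mem_univ _))
  simp only [hfib, Finset.sum_const, Finset.card_univ, smul_eq_mul, Fintype.card_fun,
    Fintype.card_fin] at htot
  have hd : d = (d - 1) + 1 := by have := p.pos; omega
  have hpow : Fintype.card F ^ d = Fintype.card F * Fintype.card F ^ (d - 1) := by
    conv_lhs => rw [hd]
    rw [pow_succ']
  rw [hpow] at htot
  exact (Nat.eq_of_mul_eq_mul_left Fintype.card_pos htot).symm

theorem card_dotProduct_ne {d : ℕ} (w : Fin d → F) (hw : w ≠ 0) (s : F) :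
    #{y : Fin d → F | w ⬝ᵥ y ≠ s} = Fintype.card F ^ d - Fintype.card F ^ (d - 1) := by
  have h := Finset.card_filter_add_card_filter_not (s := (Finset.univ : Finset (Fin d → F)))
    (fun y => w ⬝ᵥ y = s)
  rw [card_dotProduct_eq w hw, Finset.card_univ, Fintype.card_fun, Fintype.card_fin] at h
  simp only [ne_eq]
  omega

variable {k δ : ℕ} {β κ : Type*} [Fintype β] [Fintype κ]

/-- The columns of `S` represent each point of the projective space exactly once. -/
structure IsSimplexMatrix (S : Matrix (Fin k) κ F) : Prop where
  card_mul : Fintype.card κ * (Fintype.card F - 1) = Fintype.card F ^ k - 1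
  col_ne_zero : ∀ j, (fun i => S i j) ≠ 0
  col_ne_smul : ∀ j j', j ≠ j' → ∀ c : F, (fun i => S i j') ≠ c • fun i => S i j

namespace IsSimplexMatrix

variable {S : Matrix (Fin k) κ F}

theorem bijective_smul_col (hS : IsSimplexMatrix S) :
    Function.Bijective (fun p : Fˣ × κ =>
      (⟨p.1 • fun i => S i p.2, fun h => hS.col_ne_zero p.2 ((smul_eq_zero_iff_eq _).mp h)⟩ :
        {y : Fin k → F // y ≠ 0})) := by
  classical
  rw [Fintype.bijective_iff_injective_and_card]
  constructor
  · rintro ⟨a, c⟩ ⟨a', c'⟩ h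
    have h : (a • fun i => S i c) = a' • fun i => S i c' := congrArg Subtype.val h
    have hc : c = c' := by
      by_contra hne
      refine hS.col_ne_smul c c' hne ((a'⁻¹ * a : Fˣ) : F) ?_
      have h' : (fun i => S i c') = a'⁻¹ • (a • fun i => S i c) := by rw [h, inv_smul_smul]
      rw [h', smul_smul]
      rfl
    subst hc
    obtain ⟨i, hi⟩ := Function.ne_iff.mp (hS.col_ne_zero c)
    have hi : S i c ≠ 0 := hi
    have h2 : (a : F) * S i c = a' * S i c := congrFun h i
    rw [Units.ext (mul_right_cancel₀ hi h2)]
  · rw [Fintype.card_prod, Fintype.card_units, mul_comm, hS.card_mul, Fintype.card_subtype_compl,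
      Fintype.card_subtype_eq, Fintype.card_fun, Fintype.card_fin]

theorem exists_col_eq_smul_single (hS : IsSimplexMatrix S) (r : Fin k) :
    ∃ c, ∃ a : F, a ≠ 0 ∧ ∀ i, S i c = if i = r then a else 0 := by
  obtain ⟨⟨a, c⟩, h⟩ := hS.bijective_smul_col.2
    ⟨Pi.single r 1, fun h => one_ne_zero (Pi.single_eq_zero_iff.mp h)⟩
  have h : (a • fun i => S i c) = (Pi.single r 1 : Fin k → F) := congrArg Subtype.val h
  refine ⟨c, (a⁻¹ : Fˣ), Units.ne_zero _, fun i => ?_⟩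
  have hi : (a : F) * S i c = (Pi.single r 1 : Fin k → F) i := congrFun h i
  rw [Pi.single_apply] at hi
  rw [← Units.inv_mul_cancel_left a (S i c), hi]
  split_ifs <;> simp

theorem card_dotProduct_col_ne_zero (hS : IsSimplexMatrix S) (a : Fin k → F) (ha : a ≠ 0) :
    #{c | a ⬝ᵥ (fun i => S i c) ≠ 0} = Fintype.card F ^ (k - 1) := by
  classical
  have hcard : #{p : Fˣ × κ | a ⬝ᵥ (fun i => S i p.2) ≠ 0} = #{y : Fin k → F | a ⬝ᵥ y ≠ 0} := by
    refine Finset.card_bij (fun p _ => p.1 • fun i => S i p.2) ?_ ?_ ?_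
    · rintro ⟨b, c⟩ h
      simp only [Finset.mem_filter, Finset.mem_univ, true_and] at h ⊢
      rw [dotProduct_smul]
      exact fun h' => h ((smul_eq_zero_iff_eq _).mp h')
    · intro p _ p' _ h
      exact hS.bijective_smul_col.1 (Subtype.ext h)
    · intro y hy
      simp only [Finset.mem_filter, Finset.mem_univ, true_and] at hy
      have hy0 : y ≠ 0 := by rintro rfl; simp at hy
      obtain ⟨p, hp⟩ := hS.bijective_smul_col.2 ⟨y, hy0⟩
      have hp : (p.1 • fun i => S i p.2) = y := congrArg Subtype.val hp
      refine ⟨p, ?_, hp⟩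
      simp only [Finset.mem_filter, Finset.mem_univ, true_and]
      intro h
      apply hy
      rw [← hp, dotProduct_smul, h, smul_zero]
  have hprod : #{p : Fˣ × κ | a ⬝ᵥ (fun i => S i p.2) ≠ 0}
      = (Fintype.card F - 1) * #{c | a ⬝ᵥ (fun i => S i c) ≠ 0} := by
    rw [← Fintype.card_units, ← Finset.card_univ, ← Finset.card_product]
    congr 1
    ext p
    simp
  rw [card_dotProduct_ne a ha, hprod] at hcard
  obtain ⟨i, -⟩ := Function.ne_iff.mp ha
  have hk : k = (k - 1) + 1 := by have := i.pos; omega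
  have hpow : Fintype.card F ^ k - Fintype.card F ^ (k - 1)
      = (Fintype.card F - 1) * Fintype.card F ^ (k - 1) := by
    conv_lhs => rw [hk]
    rw [pow_succ', Nat.sub_mul, one_mul, Nat.add_sub_cancel]
  rw [hpow] at hcard
  have : 1 < Fintype.card F := Fintype.one_lt_card
  exact Nat.eq_of_mul_eq_mul_left (by omega) hcard

variable {x : β → Fin δ → F}

theorem hammingNorm_of_ne_zero (hS : IsSimplexMatrix S) (hx : Function.Bijective x)
    (y : β × κ → F) (a : Fin k → F) (w : Fin δ → F) (hw : w ≠ 0)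
    (hy : ∀ b c, y (b, c) = a ⬝ᵥ (fun i => S i c) + w ⬝ᵥ x b) :
    hammingNorm y = Fintype.card F ^ (δ + k - 1) - Fintype.card F ^ (δ - 1) := by
  classical
  have hfib : ∀ c, #{b | y (b, c) ≠ 0} = Fintype.card F ^ δ - Fintype.card F ^ (δ - 1) := by
    intro c
    rw [← card_dotProduct_ne w hw (-(a ⬝ᵥ fun i => S i c))]
    refine Finset.card_bij (fun b _ => x b) ?_ (fun _ _ _ _ h => hx.1 h) ?_
    · intro b hb
      simp only [Finset.mem_filter, Finset.mem_univ, true_and] at hb ⊢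
      intro h
      apply hb
      rw [hy, h, add_neg_cancel]
    · intro z hz
      obtain ⟨b, rfl⟩ := hx.2 z
      simp only [Finset.mem_filter, Finset.mem_univ, true_and] at hz
      refine ⟨b, ?_, rfl⟩
      simp only [Finset.mem_filter, Finset.mem_univ, true_and, hy]
      exact fun h => hz (eq_neg_of_add_eq_zero_right h)
  have hsum : hammingNorm y = ∑ c, #{b | y (b, c) ≠ 0} := by
    rw [hammingNorm, Finset.card_filter, Fintype.sum_prod_type, Finset.sum_comm]
    simp only [Finset.card_filter]
  obtain ⟨p, -⟩ := Function.ne_iff.mp hw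
  have hδ : δ = (δ - 1) + 1 := by have := p.pos; omega
  have hpow : Fintype.card F ^ δ - Fintype.card F ^ (δ - 1)
      = (Fintype.card F - 1) * Fintype.card F ^ (δ - 1) := by
    conv_lhs => rw [hδ]
    rw [pow_succ', Nat.sub_mul, one_mul, Nat.add_sub_cancel]
  rw [hsum, Finset.sum_congr rfl fun c _ => hfib c, Finset.sum_const, Finset.card_univ,
    smul_eq_mul, hpow, ← mul_assoc, hS.card_mul, Nat.sub_mul, one_mul, ← pow_add]
  congr 2
  omega

theorem hammingNorm_of_eq_zero (hS : IsSimplexMatrix S) (hx : Function.Bijective x)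
    (y : β × κ → F) (a : Fin k → F) (ha : a ≠ 0)
    (hy : ∀ b c, y (b, c) = a ⬝ᵥ (fun i => S i c)) :
    hammingNorm y = Fintype.card F ^ (δ + k - 1) := by
  have hβ : Fintype.card β = Fintype.card F ^ δ := by
    rw [Fintype.card_of_bijective hx, Fintype.card_fun, Fintype.card_fin]
  have hset : #{p : β × κ | y p ≠ 0} = #((Finset.univ : Finset β) ×ˢ
      ({c | a ⬝ᵥ (fun i => S i c) ≠ 0} : Finset κ)) := by
    congr 1
    ext ⟨b, c⟩
    simp [hy]
  obtain ⟨i, -⟩ := Function.ne_iff.mp ha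
  rw [hammingNorm, hset, Finset.card_product, Finset.card_univ, hβ,
    hS.card_dotProduct_col_ne_zero a ha, ← pow_add]
  congr 1
  have := i.pos
  omega

end IsSimplexMatrix

end Counting

section Encoder

variable {k δ : ℕ} {β κ : Type*}

/-- `G(z)` has the columns of `S` as constant coefficients, row degrees `ν`, and the `t`-th
coefficient of its `r`-th row reads off the coordinate `P t r` of `x b`, where distinct
pairs `(t, r)` use distinct coordinates. -/
structure IsCoordinateEncoder (S : Matrix (Fin k) κ F) (x : β → Fin δ → F)
    (G : Matrix (Fin k) (β × κ) F[X]) (ν : Fin k → ℕ) (P : ℕ → Fin k → Fin δ) : Prop where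
  coeff_zero : ∀ r b c, (G r (b, c)).coeff 0 = S r c
  coeff_pos : ∀ r b c t, 1 ≤ t → t ≤ ν r → (G r (b, c)).coeff t = x b (P t r)
  coeff_gt : ∀ r b c t, ν r < t → (G r (b, c)).coeff t = 0
  inj : ∀ t r t' r', 1 ≤ t → t ≤ ν r → 1 ≤ t' → t' ≤ ν r' → P t r = P t' r' → t = t' ∧ r = r'

/-- The coefficient vector, with respect to the coordinates of `x b`, of the `t`-th coefficient
of row `r`. -/
def tapVec (ν : Fin k → ℕ) (P : ℕ → Fin k → Fin δ) (t : ℕ) (r : Fin k) : Fin δ → F :=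
  if 1 ≤ t ∧ t ≤ ν r then Pi.single (P t r) 1 else 0

/-- The contribution of the past inputs to the output at time `t`. -/
def stateVec (ν : Fin k → ℕ) (P : ℕ → Fin k → Fin δ) (u : Fin k → F[X]) (t : ℕ) : Fin δ → F :=
  ∑ r, ∑ ij ∈ Finset.HasAntidiagonal.antidiagonal t, (u r).coeff ij.1 • tapVec ν P ij.2 r

namespace IsCoordinateEncoder

variable {S : Matrix (Fin k) κ F} {x : β → Fin δ → F} {G : Matrix (Fin k) (β × κ) F[X]}
  {ν : Fin k → ℕ} {P : ℕ → Fin k → Fin δ}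

theorem coeff_eq (h : IsCoordinateEncoder S x G ν P) (r : Fin k) (b : β) (c : κ) (t : ℕ) :
    (G r (b, c)).coeff t = (if t = 0 then S r c else 0) + tapVec ν P t r ⬝ᵥ x b := by
  rcases Nat.eq_zero_or_pos t with rfl | ht
  · simp [h.coeff_zero, tapVec]
  · rw [if_neg ht.ne', zero_add, tapVec]
    split_ifs with h1
    · rw [h.coeff_pos r b c t h1.1 h1.2, single_dotProduct, one_mul]
    · rw [h.coeff_gt r b c t (by omega), zero_dotProduct]

theorem natDegree_le (h : IsCoordinateEncoder S x G ν P) (r : Fin k) (p : β × κ) :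
    (G r p).natDegree ≤ ν r :=
  natDegree_le_iff_coeff_eq_zero.mpr fun t ht => h.coeff_gt r p.1 p.2 t ht

theorem coeffVec_sum (h : IsCoordinateEncoder S x G ν P) (u : Fin k → F[X]) (t : ℕ)
    (b : β) (c : κ) :
    coeffVec (∑ r, u r • G r) t (b, c)
      = (fun r => (u r).coeff t) ⬝ᵥ (fun r => S r c) + stateVec ν P u t ⬝ᵥ x b := by
  simp only [coeffVec, Finset.sum_apply, Pi.smul_apply, smul_eq_mul, finsetSum_coeff, coeff_mul,
    h.coeff_eq, stateVec, sum_dotProduct, smul_dotProduct]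
  rw [dotProduct, ← Finset.sum_add_distrib]
  refine Finset.sum_congr rfl fun r _ => ?_
  simp only [mul_add, Finset.sum_add_distrib, mul_ite, mul_zero]
  congr 1
  rw [Finset.sum_eq_single (t, 0)]
  · simp
  · rintro ⟨i, j⟩ hij hne
    rw [if_neg]
    rintro rfl
    simp at hij
    simp [hij] at hne
  · simp

theorem stateVec_apply (h : IsCoordinateEncoder S x G ν P) (u : Fin k → F[X]) (s t : ℕ)
    (r : Fin k) (ht : 1 ≤ t) (htr : t ≤ ν r) :
    stateVec ν P u (s + t) (P t r) = (u r).coeff s := by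
  rw [stateVec, Finset.sum_apply, Finset.sum_eq_single r, Finset.sum_apply,
    Finset.sum_eq_single (s, t)]
  · simp [tapVec, ht, htr]
  · rintro ⟨i, j⟩ hij hne
    simp only [Pi.smul_apply, tapVec]
    split_ifs with hj
    · rw [Pi.single_apply, if_neg, smul_zero]
      intro hP
      have := (h.inj _ _ _ _ ht htr hj.1 hj.2 hP).1
      rw [Finset.HasAntidiagonal.mem_antidiagonal] at hij
      dsimp only at hij
      exact hne (Prod.ext (by simp only; omega) this.symm)
    · simp
  · simp
  · intro r' _ hne
    rw [Finset.sum_apply]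
    refine Finset.sum_eq_zero fun ij _ => ?_
    simp only [Pi.smul_apply, tapVec]
    split_ifs with hj
    · rw [Pi.single_apply, if_neg, smul_zero]
      intro hP
      exact hne (h.inj _ _ _ _ ht htr hj.1 hj.2 hP).2.symm
    · simp
  · simp

end IsCoordinateEncoder

theorem stateVec_eq_zero_of_forall_lt (ν : Fin k → ℕ) (P : ℕ → Fin k → Fin δ) (u : Fin k → F[X])
    (t : ℕ) (hu : ∀ s < t, ∀ r, (u r).coeff s = 0) : stateVec ν P u t = 0 := by
  refine Finset.sum_eq_zero fun r _ => Finset.sum_eq_zero fun ij hij => ?_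
  rw [Finset.HasAntidiagonal.mem_antidiagonal] at hij
  rcases Nat.eq_zero_or_pos ij.2 with h0 | hpos
  · simp [tapVec, h0]
  · rw [hu _ (by omega), zero_smul]

section Weights

variable [Fintype F] [Fintype β] [Fintype κ] {S : Matrix (Fin k) κ F} {x : β → Fin δ → F}
  {G : Matrix (Fin k) (β × κ) F[X]} {ν : Fin k → ℕ} {P : ℕ → Fin k → Fin δ} {D : ℕ}

namespace IsCoordinateEncoder

theorem hammingNorm_add_of_le (h : IsCoordinateEncoder S x G ν P) (hS : IsSimplexMatrix S)
    (hx : Function.Bijective x) (u : Fin k → F[X]) (s t : ℕ) (r : Fin k)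
    (hr : (u r).coeff s ≠ 0) (ht : 1 ≤ t) (htr : t ≤ ν r) :
    hammingNorm (coeffVec (∑ r, u r • G r) (s + t))
      = Fintype.card F ^ (δ + k - 1) - Fintype.card F ^ (δ - 1) := by
  refine hS.hammingNorm_of_ne_zero hx _ _ _ ?_ (h.coeffVec_sum u (s + t))
  intro h0
  apply hr
  rw [← h.stateVec_apply u s t r ht htr, h0, Pi.zero_apply]

theorem hammingNorm_first (h : IsCoordinateEncoder S x G ν P) (hS : IsSimplexMatrix S)
    (hx : Function.Bijective x) (u : Fin k → F[X]) (s : ℕ) (r : Fin k)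
    (hr : (u r).coeff s ≠ 0) (hu : ∀ s' < s, ∀ r, (u r).coeff s' = 0) :
    hammingNorm (coeffVec (∑ r, u r • G r) s) = Fintype.card F ^ (δ + k - 1) := by
  refine hS.hammingNorm_of_eq_zero hx _ (fun r => (u r).coeff s) (Function.ne_iff.mpr ⟨r, hr⟩) ?_
  intro b c
  rw [h.coeffVec_sum, stateVec_eq_zero_of_forall_lt ν P u s hu, zero_dotProduct, add_zero]

theorem sum_hammingNorm (h : IsCoordinateEncoder S x G ν P) (hS : IsSimplexMatrix S)
    (hx : Function.Bijective x) (u : Fin k → F[X]) (s j : ℕ) (r : Fin k)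
    (hr : (u r).coeff s ≠ 0) (hu : ∀ s' < s, ∀ r, (u r).coeff s' = 0) (hj : j ≤ ν r) :
    ∑ t ∈ Finset.range (j + 1), hammingNorm (coeffVec (∑ r, u r • G r) (s + t))
      = Fintype.card F ^ (δ + k - 1)
        + j * (Fintype.card F ^ (δ + k - 1) - Fintype.card F ^ (δ - 1)) := by
  rw [Finset.sum_range_succ', add_zero, h.hammingNorm_first hS hx u s r hr hu, add_comm]
  congr 1
  rw [Finset.sum_congr rfl fun t ht => h.hammingNorm_add_of_le hS hx u s (t + 1) r hr (by omega)
    (by rw [Finset.mem_range] at ht; omega)]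
  simp

theorem hammingNorm_row_of_lt (h : IsCoordinateEncoder S x G ν P) (r : Fin k) (t : ℕ)
    (ht : ν r < t) : hammingNorm (coeffVec (G r) t) = 0 := by
  rw [hammingNorm_eq_zero]
  ext p
  exact h.coeff_gt r p.1 p.2 t ht

theorem sum_hammingNorm_row (h : IsCoordinateEncoder S x G ν P) (hS : IsSimplexMatrix S)
    (hx : Function.Bijective x) (j : ℕ) (r : Fin k) (hj : j ≤ ν r) :
    ∑ t ∈ Finset.range (j + 1), hammingNorm (coeffVec (G r) t)
      = Fintype.card F ^ (δ + k - 1)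
        + j * (Fintype.card F ^ (δ + k - 1) - Fintype.card F ^ (δ - 1)) := by
  have hrow : ∑ i, (Pi.single r 1 : Fin k → F[X]) i • G i = G r := by
    rw [Finset.sum_eq_single r] <;> simp +contextual
  have := h.sum_hammingNorm hS hx (Pi.single r 1) 0 j r (by simp) (by simp) hj
  simpa only [hrow, zero_add] using this

theorem coeffVec_zero_ne_zero (h : IsCoordinateEncoder S x G ν P) (hS : IsSimplexMatrix S)
    (hx : Function.Bijective x) (r : Fin k) : coeffVec (G r) 0 ≠ 0 := by
  have := h.sum_hammingNorm_row hS hx 0 r (Nat.zero_le _)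
  simp only [zero_add, Finset.sum_range_one, zero_mul, add_zero] at this
  rw [← hammingNorm_ne_zero_iff, this]
  exact pow_ne_zero _ Fintype.card_ne_zero

theorem colDist_eq (h : IsCoordinateEncoder S x G ν P) (hS : IsSimplexMatrix S)
    (hx : Function.Bijective x) (hD : ∀ r, D ≤ ν r) (r₀ : Fin k) (hr₀ : ν r₀ = D) (j : ℕ) :
    colDist (Submodule.span F[X] (Set.range fun r => G r)) j
      = Fintype.card F ^ (δ + k - 1)
        + min j D * (Fintype.card F ^ (δ + k - 1) - Fintype.card F ^ (δ - 1)) := by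
  refine le_antisymm (Nat.sInf_le ?_) (le_csInf ?_ ?_)
  · refine ⟨G r₀, Submodule.subset_span ⟨r₀, rfl⟩, h.coeffVec_zero_ne_zero hS hx r₀, ?_⟩
    rw [← h.sum_hammingNorm_row hS hx (min j D) r₀ (by omega)]
    refine Finset.sum_subset (Finset.range_mono (by omega)) fun t ht ht' => ?_
    rw [Finset.mem_range] at ht ht'
    exact h.hammingNorm_row_of_lt r₀ t (by omega)
  · exact ⟨_, G r₀, Submodule.subset_span ⟨r₀, rfl⟩, h.coeffVec_zero_ne_zero hS hx r₀, rfl⟩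
  · rintro d ⟨v, hv, hv0, rfl⟩
    obtain ⟨u, rfl⟩ := (Submodule.mem_span_range_iff_exists_fun _).mp hv
    have hr : ∃ r, (u r).coeff 0 ≠ 0 := by
      by_contra! hcon
      apply hv0
      ext ⟨b, c⟩
      rw [h.coeffVec_sum, stateVec_eq_zero_of_forall_lt ν P u 0 (by simp)]
      simp [dotProduct, hcon]
    obtain ⟨r, hr⟩ := hr
    rw [← h.sum_hammingNorm hS hx u 0 (min j D) r hr (by simp)
      ((min_le_right _ _).trans (hD r))]
    simp only [zero_add]
    exact Finset.sum_le_sum_of_subset (Finset.range_mono (by omega))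

theorem freeDist_eq (h : IsCoordinateEncoder S x G ν P) (hS : IsSimplexMatrix S)
    (hx : Function.Bijective x) (hD : ∀ r, D ≤ ν r) (r₀ : Fin k) (hr₀ : ν r₀ = D) :
    freeDist (Submodule.span F[X] (Set.range fun r => G r))
      = Fintype.card F ^ (δ + k - 1)
        + D * (Fintype.card F ^ (δ + k - 1) - Fintype.card F ^ (δ - 1)) := by
  have hne : G r₀ ≠ 0 := fun h0 => h.coeffVec_zero_ne_zero hS hx r₀ (by
    ext p
    simp [coeffVec, h0])
  refine le_antisymm (Nat.sInf_le ?_) (le_csInf ?_ ?_)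
  · refine ⟨G r₀, Submodule.subset_span ⟨r₀, rfl⟩, hne, ?_⟩
    rw [← h.sum_hammingNorm_row hS hx D r₀ hr₀.ge]
    refine (finsum_eq_sum_of_support_subset _ fun t ht => ?_).symm
    rw [Finset.coe_range, Set.mem_Iio]
    by_contra hlt
    exact ht (h.hammingNorm_row_of_lt r₀ t (by omega))
  · exact ⟨_, G r₀, Submodule.subset_span ⟨r₀, rfl⟩, hne, rfl⟩
  · rintro d ⟨v, hv, hv0, rfl⟩
    obtain ⟨u, rfl⟩ := (Submodule.mem_span_range_iff_exists_fun _).mp hv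
    have hex : ∃ s, ∃ r, (u r).coeff s ≠ 0 := by
      by_contra! hcon
      have hu : ∀ r, u r = 0 := fun r => Polynomial.ext fun s => by simp [hcon s r]
      exact hv0 (by simp [hu])
    classical
    obtain ⟨r, hr⟩ := Nat.find_spec hex
    set s := Nat.find hex
    have hmin : ∀ s' < s, ∀ r, (u r).coeff s' = 0 := fun s' hs' => by
      have := Nat.find_min hex hs'
      push Not at this
      exact this
    rw [← h.sum_hammingNorm hS hx u s D r hr hmin (hD r)]
    set v := ∑ r, u r • G r
    let N := s + D + 1 + Finset.univ.sup fun p => (v p).natDegree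
    have hsupp : Function.support (fun t => hammingNorm (coeffVec v t)) ⊆ Finset.range N := by
      intro t ht
      rw [Finset.coe_range, Set.mem_Iio]
      by_contra hlt
      apply ht
      simp only [hammingNorm_eq_zero]
      ext p
      refine coeff_eq_zero_of_natDegree_lt ?_
      have := Finset.le_sup (f := fun p => (v p).natDegree) (Finset.mem_univ p)
      simp only [N] at hlt this
      omega
    rw [finsum_eq_sum_of_support_subset _ hsupp]
    refine (Finset.sum_map (Finset.range (D + 1)) (addLeftEmbedding s)
        (fun t => hammingNorm (coeffVec v t))).symm.trans_le ?_
    refine Finset.sum_le_sum_of_subset fun t ht => ?_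
    simp only [Finset.mem_map, Finset.mem_range, addLeftEmbedding_apply] at ht ⊢
    omega

end IsCoordinateEncoder

end Weights

section DiagonalColumns

variable {k : ℕ} {ι : Type*} {G : Matrix (Fin k) ι F[X]} {col : Fin k → ι} {a : Fin k → F[X]ˣ}

theorem sum_smul_apply_col (hcol : ∀ r' r, G r' (col r) = if r' = r then (a r : F[X]) else 0)
    (u : Fin k → F[X]) (r : Fin k) : (∑ r, u r • G r) (col r) = u r * a r := by
  simp [Finset.sum_apply, hcol]

theorem linearIndependent_of_diagonal_columns
    (hcol : ∀ r' r, G r' (col r) = if r' = r then (a r : F[X]) else 0) :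
    LinearIndependent F[X] (fun r => G r) := by
  rw [Fintype.linearIndependent_iff]
  intro u hu r
  have h := sum_smul_apply_col hcol u r
  rw [hu, Pi.zero_apply] at h
  exact (Units.mul_left_eq_zero (a r)).mp h.symm

theorem isNoncatastrophic_of_diagonal_columns [Fintype ι]
    (hcol : ∀ r' r, G r' (col r) = if r' = r then (a r : F[X]) else 0) :
    IsNoncatastrophic k (Submodule.span F[X] (Set.range fun r => G r)) := by
  classical
  have hinj : Function.Injective col := by
    intro r r' h
    by_contra hne
    have h1 := hcol r r'
    rw [← h, hcol r r, if_pos rfl, if_neg hne] at h1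
    exact (a r).ne_zero h1
  have hcard : Fintype.card {j // j ∉ Set.range col} = Fintype.card ι - k := by
    rw [Fintype.card_subtype_compl (fun j => j ∈ Set.range col)]
    congr 1
    exact (Set.card_range_of_injective hinj).trans (Fintype.card_fin k)
  let ε := (Fintype.equivFinOfCardEq hcard).symm
  have hε : ∀ i r, (ε i : ι) ≠ col r := fun i r h => (ε i).2 ⟨r, h.symm⟩
  let H : Matrix (Fin (Fintype.card ι - k)) ι F[X] := fun i =>
    Pi.single (ε i : ι) 1 - ∑ r, Pi.single (col r) (((a r)⁻¹ : F[X]ˣ) * G r (ε i))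
  have hH : ∀ v i, H.mulVec v i
      = v (ε i) - ∑ r, ((a r)⁻¹ : F[X]ˣ) * G r (ε i) * v (col r) := by
    intro v i
    change (_ - _) ⬝ᵥ v = _
    simp [sub_dotProduct, sum_dotProduct]
  refine ⟨H, ?_, fun v => ⟨fun hv => ?_, fun hv => ?_⟩⟩
  · rw [Fintype.linearIndependent_iff]
    intro g hg i
    have hi := congrFun hg (ε i)
    have hHε : ∀ i', H i' (ε i) = if i' = i then 1 else 0 := by
      intro i'
      simp [H, Pi.single_apply, hε, Subtype.val_inj, eq_comm]
    simpa [Finset.sum_apply, hHε] using hi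
  · obtain ⟨u, rfl⟩ := (Submodule.mem_span_range_iff_exists_fun _).mp hv
    ext1 i
    rw [hH, Pi.zero_apply, sub_eq_zero, Finset.sum_apply]
    refine Finset.sum_congr rfl fun r _ => ?_
    rw [sum_smul_apply_col hcol, Pi.smul_apply, smul_eq_mul, mul_comm (u r) (a r : F[X]),
      mul_comm (((a r)⁻¹ : F[X]ˣ) : F[X]), mul_assoc, Units.inv_mul_cancel_left, mul_comm]
  · refine (Submodule.mem_span_range_iff_exists_fun _).mpr
      ⟨fun r => v (col r) * ((a r)⁻¹ : F[X]ˣ), ?_⟩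
    ext1 j
    by_cases hj : j ∈ Set.range col
    · obtain ⟨r, rfl⟩ := hj
      rw [sum_smul_apply_col hcol, Units.inv_mul_cancel_right]
    · obtain ⟨i, hi⟩ := ε.surjective ⟨j, hj⟩
      have h := congrFun hv i
      rw [hH, Pi.zero_apply, sub_eq_zero, hi] at h
      rw [h, Finset.sum_apply]
      refine Finset.sum_congr rfl fun r _ => ?_
      rw [Pi.smul_apply, smul_eq_mul]
      ring

end DiagonalColumns

namespace IsCoordinateEncoder

variable [Fintype F] [Fintype β] [Fintype κ] {S : Matrix (Fin k) κ F} {x : β → Fin δ → F}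
  {G : Matrix (Fin k) (β × κ) F[X]} {ν : Fin k → ℕ} {P : ℕ → Fin k → Fin δ}

theorem exists_diagonal_columns (h : IsCoordinateEncoder S x G ν P) (hS : IsSimplexMatrix S)
    (hx : Function.Bijective x) :
    ∃ (col : Fin k → β × κ) (a : Fin k → F[X]ˣ),
      ∀ r' r, G r' (col r) = if r' = r then (a r : F[X]) else 0 := by
  obtain ⟨b, hb⟩ := hx.2 0
  choose c a ha hc using hS.exists_col_eq_smul_single
  refine ⟨fun r => (b, c r), fun r => Units.map (C : F →+* F[X]).toMonoidHom (Units.mk0 _ (ha r)),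
    fun r' r => ?_⟩
  have hconst : G r' (b, c r) = C (S r' (c r)) := by
    ext t
    rw [h.coeff_eq, hb, dotProduct_zero, add_zero, coeff_C]
  rw [hconst, hc]
  split_ifs <;> simp

theorem exists_leading_columns (h : IsCoordinateEncoder S x G ν P) (hS : IsSimplexMatrix S)
    (hx : Function.Bijective x) :
    ∃ (f : Fin k ↪ β × κ) (a : Fin k → F), (∀ r, a r ≠ 0) ∧
      ∀ r' r, (G r' (f r)).coeff (ν r') = if r' = r then a r else 0 := by
  choose c a ha hc using hS.exists_col_eq_smul_single
  choose b hb using fun r => hx.2 (tapVec ν P (ν r) r)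
  have hinj : Function.Injective c := by
    intro r r' hrr
    by_contra hne
    have h1 := hc r' r
    rw [← hrr, hc r r, if_pos rfl, if_neg hne] at h1
    exact ha r h1
  refine ⟨⟨fun r => (b r, c r), fun r r' hrr => hinj (Prod.ext_iff.mp hrr).2⟩,
    fun r => if ν r = 0 then a r else 1, fun r => ?_, fun r' r => ?_⟩
  · dsimp only
    split_ifs
    exacts [ha r, one_ne_zero]
  · change (G r' (b r, c r)).coeff (ν r') = _
    rcases Nat.eq_zero_or_pos (ν r') with h0 | hpos
    · rw [h0, h.coeff_zero, hc]
      by_cases hrr : r' = r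
      · subst hrr
        simp [h0]
      · simp [hrr]
    · rw [h.coeff_pos r' _ _ _ hpos le_rfl, hb, tapVec]
      by_cases hrr : r' = r
      · subst hrr
        rw [if_pos ⟨hpos, le_rfl⟩, Pi.single_eq_same, if_pos rfl]
        exact (if_neg hpos.ne').symm
      · rw [if_neg hrr]
        split_ifs with h1
        · rw [Pi.single_apply, if_neg]
          exact fun hP => hrr (h.inj _ _ _ _ hpos le_rfl h1.1 h1.2 hP).2
        · rfl

theorem hasParams [DecidableEq β] [DecidableEq κ] (h : IsCoordinateEncoder S x G ν P)
    (hS : IsSimplexMatrix S) (hx : Function.Bijective x)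
    (hlin : LinearIndependent F[X] fun r => G r) (hsum : ∑ r, ν r = δ) :
    HasParams k δ (Submodule.span F[X] (Set.range fun r => G r)) := by
  obtain ⟨f, a, ha, hf⟩ := h.exists_leading_columns hS hx
  have hext : extDeg G = δ := by
    rw [← hsum]
    refine Finset.sum_congr rfl fun r _ => le_antisymm
      (Finset.sup_le fun p _ => h.natDegree_le r p) ?_
    refine le_trans ?_ (Finset.le_sup (Finset.mem_univ (f r)))
    refine le_natDegree_of_ne_zero ?_
    rw [hf, if_pos rfl]
    exact ha r
  refine ⟨G, ⟨hlin, rfl⟩, ?_, hext⟩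
  rw [hext]
  refine le_antisymm (Finset.sup_le fun g _ => ?_) ?_
  · rw [← hsum]
    exact natDegree_det_le_sum _ ν fun i j => h.natDegree_le i (g j)
  · refine le_trans ?_ (Finset.le_sup (Finset.mem_univ f))
    rw [← hsum]
    refine le_natDegree_of_ne_zero ?_
    rw [coeff_det_sum_of_natDegree_le (G.submatrix id fun i => f i) ν
      fun i j => h.natDegree_le i (f j)]
    have hdiag : (Matrix.of fun i j => ((G.submatrix id fun i => f i) i j).coeff (ν i))
        = Matrix.diagonal a := by
      ext i j
      rw [Matrix.of_apply, Matrix.submatrix_apply, id, hf, Matrix.diagonal_apply]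
      split_ifs with hij
      · rw [hij]
      · rfl
    rw [hdiag, Matrix.det_diagonal]
    exact Finset.prod_ne_zero_iff.mpr fun r _ => ha r

end IsCoordinateEncoder

end Encoder

/-- **Construction 1.** The `(q^δ(q^k−1)/(q−1), k, δ)` convolutional code whose stacked
coefficient matrix is the MacDonald generator matrix `((S(q,k) ⋯ S(q,k)); (X_1 ⋯ X_{q^δ}))`
is non-catastrophic, has column distances
`d_j^c = q^{δ+k−1} + min(j,⌊δ/k⌋)·(q^{δ+k−1} − q^{δ−1})`, and free distance
`q^{δ+k−1} + ⌊δ/k⌋·(q^{δ+k−1} − q^{δ−1})`. -/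
theorem stmt_8 {F : Type*} [Field F] [Fintype F] [DecidableEq F]
    (q k δ Nk μ : ℕ) (hq : Fintype.card F = q)
    (hk : 1 ≤ k) (hδ : 1 ≤ δ)
    (hNk : Nk * (q - 1) = q ^ k - 1)
    (hμ : μ = (δ + k - 1) / k)
    (S : Matrix (Fin k) (Fin Nk) F)
    (hS1 : ∀ j, (fun i => S i j) ≠ 0)
    (hS2 : ∀ j j', j ≠ j' → ∀ c : F, (fun i => S i j') ≠ c • fun i => S i j)
    (x : Fin (q ^ δ) → Fin δ → F) (hx : Function.Bijective x)
    (Gc : ℕ → Matrix (Fin k) (Fin (q ^ δ) × Fin Nk) F)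
    (e : Fin (δ + k - k * μ) → Fin k) (he : StrictMono e)
    (h0 : ∀ (r : Fin k) (b : Fin (q ^ δ)) (c : Fin Nk), Gc 0 r (b, c) = S r c)
    (hmid : ∀ i, 1 ≤ i → i < μ → ∀ (r : Fin k) (b : Fin (q ^ δ)) (c : Fin Nk),
        Gc i r (b, c) = padded (x b) ((i - 1) * k + r.val))
    (hlast : ∀ (s : Fin (δ + k - k * μ)) (b : Fin (q ^ δ)) (c : Fin Nk),
        Gc μ (e s) (b, c) = padded (x b) ((μ - 1) * k + s.val))
    (hzero : ∀ r : Fin k, r ∉ Set.range e → Gc μ r = 0)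
    (G : Matrix (Fin k) (Fin (q ^ δ) × Fin Nk) (Polynomial F))
    (hG : ∀ r c, G r c = ∑ i ∈ Finset.range (μ + 1), Polynomial.C (Gc i r c) * Polynomial.X ^ i) :
    LinearIndependent (Polynomial F) (fun r => G r) ∧
    IsNoncatastrophic k (Submodule.span (Polynomial F) (Set.range fun r => G r)) ∧
    HasParams k δ (Submodule.span (Polynomial F) (Set.range fun r => G r)) ∧
    (∀ j : ℕ, colDist (Submodule.span (Polynomial F) (Set.range fun r => G r)) j
        = q ^ (δ + k - 1) + min j (δ / k) * (q ^ (δ + k - 1) - q ^ (δ - 1))) ∧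
    freeDist (Submodule.span (Polynomial F) (Set.range fun r => G r))
        = q ^ (δ + k - 1) + (δ / k) * (q ^ (δ + k - 1) - q ^ (δ - 1)) := by
  classical
  subst hq
  have hδμ : δ ≤ k * μ := by
    have := Nat.lt_mul_div_succ (δ + k - 1) hk
    rw [← hμ, Nat.mul_add] at this
    omega
  have hμδ : k * μ < δ + k := by
    have := Nat.mul_div_le (δ + k - 1) k
    rw [← hμ] at this
    omega
  have hμ1 : 1 ≤ μ := by
    rcases Nat.eq_zero_or_pos μ with h | h
    · rw [h] at hδμ; omega
    · exact h
  have hμk : k * μ = (μ - 1) * k + k := by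
    obtain ⟨m, rfl⟩ := Nat.exists_eq_add_of_le' hμ1
    rw [Nat.add_sub_cancel]; ring
  have hsimp : IsSimplexMatrix S := ⟨by simpa using hNk, hS1, hS2⟩
  let ν : Fin k → ℕ := fun r => if r ∈ Set.range e then μ else μ - 1
  have hν : ∀ r, μ - 1 ≤ ν r ∧ ν r ≤ μ := fun r => by
    simp only [ν]; split_ifs <;> omega
  have hνe : ∀ r, ν r = μ → r ∈ Set.range e := fun r hr => by
    by_contra hne
    simp only [ν, if_neg hne] at hr
    omega
  have hexs : ∀ r, ∃ s : ℕ, r ∈ Set.range e → ∃ h : s < δ + k - k * μ, e ⟨s, h⟩ = r := by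
    intro r
    by_cases hr : r ∈ Set.range e
    · obtain ⟨s, hs⟩ := hr
      exact ⟨s, fun _ => ⟨s.2, hs⟩⟩
    · exact ⟨0, fun h => absurd h hr⟩
  choose s hs using hexs
  let off : ℕ → Fin k → ℕ := fun t r => if t < μ then r.val else s r
  have hoff : ∀ t r, t ≤ ν r → off t r < k := by
    intro t r ht
    simp only [off]
    split_ifs with h
    · exact r.2
    · obtain ⟨h', -⟩ := hs r (hνe r (by have := hν r; omega))
      omega
  have hpos : ∀ t r, 1 ≤ t → t ≤ ν r → (t - 1) * k + off t r < δ := by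
    intro t r ht htr
    have hlt := hoff t r htr
    by_cases h : t < μ
    · have : (t - 1 + 1) * k ≤ (μ - 1) * k := Nat.mul_le_mul_right k (by omega)
      rw [Nat.add_mul] at this
      omega
    · have htμ : t = μ := by have := hν r; omega
      obtain ⟨h', -⟩ := hs r (hνe r (by have := hν r; omega))
      have : off t r = s r := if_neg h
      rw [this, htμ]
      omega
  let P : ℕ → Fin k → Fin δ := fun t r => ⟨((t - 1) * k + off t r) % δ, Nat.mod_lt _ hδ⟩
  have hP : ∀ t r, 1 ≤ t → t ≤ ν r → (P t r).val = (t - 1) * k + off t r := fun t r ht htr =>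
    Nat.mod_eq_of_lt (hpos t r ht htr)
  have hGcoeff : ∀ r c t, (G r c).coeff t = if t ≤ μ then Gc t r c else 0 := by
    intro r c t
    rw [hG, finsetSum_coeff]
    simp [coeff_X_pow]
  have henc : IsCoordinateEncoder S x G ν P := by
    refine ⟨fun r b c => ?_, fun r b c t ht htr => ?_, fun r b c t ht => ?_, ?_⟩
    · rw [hGcoeff, if_pos (Nat.zero_le _), h0]
    · have hx' : padded (x b) ((t - 1) * k + off t r) = x b (P t r) := by
        rw [padded, dif_pos (hpos t r ht htr)]
        exact congrArg (x b) (Fin.ext (hP t r ht htr).symm)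
      rw [hGcoeff, if_pos (htr.trans (hν r).2), ← hx']
      by_cases h : t < μ
      · rw [hmid t ht h, show off t r = r.val from if_pos h]
      · have htμ : t = μ := by have := hν r; omega
        obtain ⟨h', he'⟩ := hs r (hνe r (by have := hν r; omega))
        rw [show off t r = s r from if_neg h, htμ, ← hlast ⟨s r, h'⟩ b c, he']
    · rw [hGcoeff]
      split_ifs with h
      · have htμ : t = μ := by have := hν r; omega
        have hr : r ∉ Set.range e := fun hr => by
          simp only [ν, if_pos hr] at ht
          omega
        rw [htμ, hzero r hr, Pi.zero_apply]
      · rfl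
    · intro t r t' r' ht htr ht' htr' hPP
      have hval := congrArg Fin.val hPP
      rw [hP t r ht htr, hP t' r' ht' htr'] at hval
      have h1 := hoff t r htr
      have h2 := hoff t' r' htr'
      have hdiv := congrArg (· / k) hval
      have hmod := congrArg (· % k) hval
      simp only [Nat.mul_add_mod_of_lt h1, Nat.mul_add_mod_of_lt h2] at hmod
      simp only [mul_comm _ k, Nat.mul_add_div hk, Nat.div_eq_of_lt h1,
        Nat.div_eq_of_lt h2, add_zero] at hdiv
      have htt : t = t' := by omega
      refine ⟨htt, ?_⟩
      subst htt
      by_cases h : t < μ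
      · simp only [off, if_pos h] at hmod
        exact Fin.ext hmod
      · simp only [off, if_neg h] at hmod
        obtain ⟨h3, h4⟩ := hs r (hνe r (by have := hν r; omega))
        obtain ⟨h5, h6⟩ := hs r' (hνe r' (by have := hν r'; omega))
        rw [← h4, ← h6]
        exact congrArg e (Fin.ext hmod)
  have hsum : ∑ r, ν r = δ := by
    have hν' : ∀ r, ν r = (μ - 1) + if r ∈ Set.range e then 1 else 0 := fun r => by
      simp only [ν]; split_ifs <;> omega
    have hcard : #{r | r ∈ Set.range e} = δ + k - k * μ := by
      refine Eq.trans ?_ ((Finset.card_image_of_injective Finset.univ he.injective).trans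
        (by rw [Finset.card_univ, Fintype.card_fin]))
      congr 1
      ext r
      simp
    rw [Finset.sum_congr rfl fun r _ => hν' r, Finset.sum_add_distrib, ← Finset.card_filter, hcard]
    simp only [Finset.sum_const, Finset.card_univ, Fintype.card_fin, smul_eq_mul]
    rw [mul_comm k (μ - 1)]
    omega
  have hdiv_ge : μ - 1 ≤ δ / k := (Nat.le_div_iff_mul_le hk).mpr (by omega)
  have hD : (∀ r, δ / k ≤ ν r) ∧ ∃ r₀, ν r₀ = δ / k := by
    by_cases hsurj : Function.Surjective e
    · have hcard := Fintype.card_of_bijective ⟨he.injective, hsurj⟩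
      rw [Fintype.card_fin, Fintype.card_fin] at hcard
      have hdiv : δ / k = μ := by
        rw [show δ = k * μ by omega, Nat.mul_div_cancel_left _ hk]
      have hall : ∀ r, ν r = μ := fun r => if_pos (hsurj r)
      exact ⟨fun r => by rw [hall, hdiv], ⟨0, hk⟩, by rw [hall, hdiv]⟩
    · have hdiv : δ / k < μ := by
        rw [Nat.div_lt_iff_lt_mul hk, mul_comm]
        by_contra hge
        have hcard : δ + k - k * μ = k := by omega
        exact hsurj ((Fintype.bijective_iff_injective_and_card e).mpr
          ⟨he.injective, by simp [hcard]⟩).2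
      refine ⟨fun r => by have := hν r; omega, ?_⟩
      obtain ⟨r, hr⟩ := not_forall.mp hsurj
      have hr' : ν r = μ - 1 := if_neg hr
      exact ⟨r, by omega⟩
  obtain ⟨hD, r₀, hr₀⟩ := hD
  obtain ⟨col, a, hcol⟩ := henc.exists_diagonal_columns hsimp hx
  have hlin := linearIndependent_of_diagonal_columns hcol
  exact ⟨hlin, isNoncatastrophic_of_diagonal_columns hcol, henc.hasParams hsimp hx hlin hsum,
    henc.colDist_eq hsimp hx hD r₀ hr₀, henc.freeDist_eq hsimp hx hD r₀ hr₀⟩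
end
end

section
/- Decoding of first order Reed–Muller codes via the matrix B_z: Let q ≥ 2, m ≥ 1, n = q^m, and φ : {0,…,q−1} → F_q a bijection with φ(0) = 0 extended digitwise. Let g_0, …, g_{m−1} ∈ F_q^{n} be the rows of the matrix G' whose j-th column is the digit vector (φ(j_0), …, φ(j_{m−1})) for j = j_0 + j_1 q + … + j_{m−1} q^{m−1}, and for i = i_0 + i_1 q + … + i_{m−1} q^{m−1} let b_i = φ(i_0) g_0 + … + φ(i_{m−1}) g_{m−1}. Let R(q,m) be the code spanned by g_0, …, g_{m−1} and the all-one vector 𝟙 ∈ F_q^n. Then for every received word w ∈ F_q^n: (1) the map (i, ℓ) ↦ b_i + φ(ℓ)·𝟙 is a bijection from {0,…,q^m−1} × {0,…,q−1} onto R(q,m), and (2) for all such i, ℓ, the ℓ-th component of (b_i)_z ⋆ S_w equals n − d(b_i + φ(ℓ)·𝟙, w), where d is Hamming distance; hence computing B_z ⋆ S_w yields the distances between w and all codewords of R(q,m). -/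
/-- The `q`-ary digit expansion, read in `F` through a digit-to-field bijection, is a bijection
from `{0, …, q ^ m - 1}` onto `F ^ m`. -/
theorem exists_equiv_digits {F : Type*} {q : ℕ} (m : ℕ) (e : Fin q ≃ F) (φd : ℕ → F)
    (hφd : ∀ (t : ℕ) (h : t < q), φd t = e ⟨t, h⟩) :
    ∃ D : Fin (q ^ m) ≃ (Fin m → F), ∀ i ℓ, D i ℓ = φd (i.val / q ^ (ℓ : ℕ) % q) := by
  refine ⟨finFunctionFinEquiv.symm.trans (Equiv.piCongrRight fun _ => e), fun i ℓ => ?_⟩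
  have hlt : i.val / q ^ (ℓ : ℕ) % q < q := (finFunctionFinEquiv.symm i ℓ).isLt
  rw [hφd _ hlt]
  rfl

/-- Affine functions on `F ^ m` are determined by their coefficients. -/
theorem affine_coeff_injective {F : Type*} [Field F] {m : ℕ} {a a' : Fin m → F} {c c' : F}
    (h : ∀ x : Fin m → F, ∑ ℓ, a ℓ * x ℓ + c = ∑ ℓ, a' ℓ * x ℓ + c') : a = a' ∧ c = c' := by
  have hc : c = c' := by simpa using h 0
  refine ⟨funext fun k => ?_, hc⟩
  simpa [hc, Pi.single_apply] using h (Pi.single k 1)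

/-- The vectors in the span of a finite family and the all-one vector. -/
theorem mem_span_range_union_one_iff {F ι κ : Type*} [Field F] [Fintype ι] (g : ι → κ → F)
    (v : κ → F) :
    v ∈ Submodule.span F (Set.range g ∪ {fun _ => 1}) ↔
      ∃ (a : ι → F) (c : F), ∀ j, ∑ ℓ, a ℓ * g ℓ j + c = v j := by
  simp only [Submodule.span_union, Submodule.mem_sup, Submodule.mem_span_range_iff_exists_fun,
    Submodule.mem_span_singleton]
  constructor
  · rintro ⟨_, ⟨a, rfl⟩, _, ⟨c, rfl⟩, rfl⟩
    exact ⟨a, c, fun j => by simp⟩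
  · rintro ⟨a, c, h⟩
    exact ⟨_, ⟨a, rfl⟩, _, ⟨c, rfl⟩, funext fun j => by simp [← h j]⟩

/-- The number of agreements of two words is the length minus their Hamming distance. -/
theorem sum_ite_eq_card_sub_hammingDist {ι α : Type*} [Fintype ι] [DecidableEq α]
    (v w : ι → α) :
    ∑ j, (if w j = v j then (1 : ℝ) else 0) = (Fintype.card ι : ℝ) - (hammingDist v w : ℝ) := by
  have h : ∑ j, (if w j = v j then (1 : ℝ) else 0) + (hammingDist v w : ℝ) = Fintype.card ι := by
    rw [hammingDist, Finset.card_filter, Nat.cast_sum, ← Finset.sum_add_distrib]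
    have h1 : ∀ j, (if w j = v j then (1 : ℝ) else 0) +
        ((if v j ≠ w j then 1 else 0 : ℕ) : ℝ) = 1 := fun j => by
      by_cases hj : v j = w j
      · simp [hj]
      · simp [hj, Ne.symm hj]
    simp only [h1, Finset.sum_const, Finset.card_univ, nsmul_eq_mul, mul_one]
  linarith

/-- **Decoding of first order Reed–Muller codes via `B_z`.** With `φd` the digit-to-field
bijection (with `φd 0 = 0`), `g_ℓ` the evaluation rows (`g_ℓ(j) = φ(j_ℓ)` for the `q`-ary
digits of `j`), `b_i = ∑_ℓ φ(i_ℓ)·g_ℓ`, and `R(q,m)` the span of the `g_ℓ` and the all-one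
vector: (1) `(i,ℓ) ↦ b_i + φ(ℓ)·𝟙` is a bijection onto `R(q,m)`, and (2) the `ℓ`-th
component of `(b_i)_z ⋆ S_w` equals `n − d(b_i + φ(ℓ)·𝟙, w)`. -/
theorem stmt_12 {F : Type*} [Field F] [Fintype F] [DecidableEq F]
    (q m : ℕ) (hq : Fintype.card F = q) (hm : 1 ≤ m)
    (e : Fin q ≃ F)
    (φd : ℕ → F) (hφd : ∀ (t : ℕ) (h : t < q), φd t = e ⟨t, h⟩) (hφ0 : φd 0 = 0)
    (g : Fin m → Fin (q ^ m) → F)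
    (hg : ∀ (ℓ : Fin m) (j : Fin (q ^ m)), g ℓ j = φd (j.val / q ^ (ℓ : ℕ) % q))
    (b : Fin (q ^ m) → Fin (q ^ m) → F)
    (hb : ∀ i j, b i j = ∑ ℓ : Fin m, φd (i.val / q ^ (ℓ : ℕ) % q) * g ℓ j)
    (w : Fin (q ^ m) → F)
    (s : Fin (q ^ m) → Fin q → ℝ)
    (hs : ∀ i j, s i j = if w i = e j then 1 else 0) :
    Set.BijOn (fun p : Fin (q ^ m) × Fin q => fun j => b p.1 j + e p.2)
      Set.univ
      ((Submodule.span F (Set.range g ∪ {fun _ => 1}) :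
          Submodule F (Fin (q ^ m) → F)) : Set (Fin (q ^ m) → F)) ∧
    ∀ (i : Fin (q ^ m)) (ℓ : Fin q),
      ∑ j : Fin (q ^ m), s j (e.symm (e ℓ + b i j)) =
        ((q ^ m : ℕ) : ℝ) - (hammingDist (fun j => b i j + e ℓ) w : ℝ) := by
  obtain ⟨D, hD⟩ := exists_equiv_digits m e φd hφd
  simp only [← hD] at hg hb
  refine ⟨⟨?_, ?_, ?_⟩, fun i ℓ => ?_⟩
  · rintro ⟨i, ℓ⟩ -
    exact (mem_span_range_union_one_iff g _).2 ⟨D i, e ℓ, fun j => by simp only [hb]⟩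
  · rintro ⟨i, ℓ⟩ - ⟨i', ℓ'⟩ - h
    have key : D i = D i' ∧ e ℓ = e ℓ' := affine_coeff_injective fun x => by
      simpa [hb, hg] using congrFun h (D.symm x)
    rw [D.injective key.1, e.injective key.2]
  · intro v hv
    obtain ⟨a, c, h⟩ := (mem_span_range_union_one_iff g v).1 hv
    exact ⟨(D.symm a, e.symm c), Set.mem_univ _, funext fun j => by simp [hb, ← h j]⟩
  · have h := sum_ite_eq_card_sub_hammingDist (fun j => b i j + e ℓ) w
    rw [Fintype.card_fin] at h
    simpa only [hs, Equiv.apply_symm_apply, add_comm (e ℓ)] using h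
end

section
/- Relative comparison of the three constructions: Let q ≥ 2, k ≥ 1, δ ≥ 1 and j be integers with 0 ≤ j ≤ δ. Then, as rational numbers, j·(q−1)/q + q^{k−1}(q−1)/(q^k−1) > (j+1)·((q−1)/q)·(q^{δ+k}/(q^{δ+k}−1)) > (j+1)·(q−1)/q. Equivalently (first inequality in integer form): j(q^k−1)(q^{δ+k}−1) + q^k(q^{δ+k}−1) > (j+1)·q^{δ+k}·(q^k−1), which holds whenever j < q^k(q^δ−1)/(q^k−1), in particular for all j ≤ δ. -/
/-- The integer form of the comparison, with `A = q ^ k` and `D = q ^ δ`. -/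
lemma integer_comparison_of_lt_div {A D x : ℚ} (hA : 1 < A) (h : x < A * (D - 1) / (A - 1)) :
    (x + 1) * (D * A) * (A - 1) < x * (A - 1) * (D * A - 1) + A * (D * A - 1) := by
  rw [lt_div_iff₀ (by linarith)] at h
  linarith

/-- The bound `j ≤ δ` implies the sufficient condition for the integer comparison. -/
lemma natCast_lt_mul_pow_sub_one_div {q δ j : ℕ} {A : ℚ} (hq : 2 ≤ q) (hδ : 1 ≤ δ)
    (hj : j ≤ δ) (hA : 1 < A) : (j : ℚ) < A * ((q : ℚ) ^ δ - 1) / (A - 1) := by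
  have hjD : (j : ℚ) + 1 ≤ (q : ℚ) ^ δ := by
    exact_mod_cast Nat.succ_le_of_lt (hj.trans_lt (Nat.lt_pow_self hq))
  have hD : 1 < (q : ℚ) ^ δ := one_lt_pow₀ (by exact_mod_cast hq) (by omega)
  rw [lt_div_iff₀ (by linarith)]
  nlinarith

/-- Dividing the integer form by `(A - 1) * (P - 1)` gives the fractional form. -/
lemma fractional_comparison {A P x : ℚ} (hA : 1 < A) (hP : 1 < P)
    (h : (x + 1) * P * (A - 1) < x * (A - 1) * (P - 1) + A * (P - 1)) :
    (x + 1) * (P / (P - 1)) < x + A / (A - 1) := by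
  have hA' : 0 < A - 1 := by linarith
  have hP' : 0 < P - 1 := by linarith
  rw [← mul_div_assoc, ← sub_lt_iff_lt_add', div_sub' hP'.ne', div_lt_div_iff₀ hP' hA']
  linarith

/-- **Relative comparison of the three constructions.** For `0 ≤ j ≤ δ`, as rational
numbers, `d_{j,1}/n_1 > d_{j,3}/n_3 > d_{j,2}/n_2`; in integer form the first inequality
reads `j(q^k−1)(q^{δ+k}−1) + q^k(q^{δ+k}−1) > (j+1)·q^{δ+k}·(q^k−1)`, which holds whenever
`j < q^k(q^δ−1)/(q^k−1)`, in particular for all `j ≤ δ`. -/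
theorem stmt_18 (q k δ j : ℕ) (hq : 2 ≤ q) (hk : 1 ≤ k) (hδ : 1 ≤ δ) (hj : j ≤ δ) :
    ((j : ℚ) * (q - 1) / q + (q : ℚ) ^ (k - 1) * (q - 1) / ((q : ℚ) ^ k - 1) >
        ((j : ℚ) + 1) * (((q : ℚ) - 1) / q) * ((q : ℚ) ^ (δ + k) / ((q : ℚ) ^ (δ + k) - 1))) ∧
    (((j : ℚ) + 1) * (((q : ℚ) - 1) / q) * ((q : ℚ) ^ (δ + k) / ((q : ℚ) ^ (δ + k) - 1)) >
        ((j : ℚ) + 1) * ((q : ℚ) - 1) / q) ∧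
    ((j : ℚ) * ((q : ℚ) ^ k - 1) * ((q : ℚ) ^ (δ + k) - 1) +
          (q : ℚ) ^ k * ((q : ℚ) ^ (δ + k) - 1) >
        ((j : ℚ) + 1) * (q : ℚ) ^ (δ + k) * ((q : ℚ) ^ k - 1)) ∧
    (∀ j' : ℕ, (j' : ℚ) < (q : ℚ) ^ k * ((q : ℚ) ^ δ - 1) / ((q : ℚ) ^ k - 1) →
        (j' : ℚ) * ((q : ℚ) ^ k - 1) * ((q : ℚ) ^ (δ + k) - 1) +
            (q : ℚ) ^ k * ((q : ℚ) ^ (δ + k) - 1) >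
          ((j' : ℚ) + 1) * (q : ℚ) ^ (δ + k) * ((q : ℚ) ^ k - 1)) := by
  have hq1 : (1 : ℚ) < q := by exact_mod_cast hq
  have hA : 1 < (q : ℚ) ^ k := one_lt_pow₀ hq1 (by omega)
  have hP : 1 < (q : ℚ) ^ (δ + k) := one_lt_pow₀ hq1 (by omega)
  have hr : 0 < ((q : ℚ) - 1) / q := div_pos (by linarith) (by linarith)
  have hint : ∀ i : ℕ, (i : ℚ) < (q : ℚ) ^ k * ((q : ℚ) ^ δ - 1) / ((q : ℚ) ^ k - 1) →
      ((i : ℚ) + 1) * (q : ℚ) ^ (δ + k) * ((q : ℚ) ^ k - 1) <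
        (i : ℚ) * ((q : ℚ) ^ k - 1) * ((q : ℚ) ^ (δ + k) - 1) +
          (q : ℚ) ^ k * ((q : ℚ) ^ (δ + k) - 1) := fun i hi => by
    rw [pow_add]
    exact integer_comparison_of_lt_div hA hi
  have hjint := hint j (natCast_lt_mul_pow_sub_one_div hq hδ hj hA)
  refine ⟨?_, ?_, hjint, hint⟩
  · have hk' : (q : ℚ) ^ (k - 1) = (q : ℚ) ^ k / q :=
      eq_div_of_mul_eq (by linarith) (pow_sub_one_mul (by omega) _)
    rw [hk', gt_iff_lt]
    calc ((j : ℚ) + 1) * (((q : ℚ) - 1) / q) * ((q : ℚ) ^ (δ + k) / ((q : ℚ) ^ (δ + k) - 1))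
        = ((q : ℚ) - 1) / q *
            (((j : ℚ) + 1) * ((q : ℚ) ^ (δ + k) / ((q : ℚ) ^ (δ + k) - 1))) := by ring
      _ < ((q : ℚ) - 1) / q * ((j : ℚ) + (q : ℚ) ^ k / ((q : ℚ) ^ k - 1)) :=
          mul_lt_mul_of_pos_left (fractional_comparison hA hP hjint) hr
      _ = _ := by ring
  · rw [gt_iff_lt, mul_div_assoc]
    refine lt_mul_of_one_lt_right (by positivity) ?_
    rw [one_lt_div (by linarith)]
    linarith
end

section
/- Parity-check characterization of non-catastrophic convolutional codes: Let C be an (n,k) convolutional code over F_q with generator matrix G(z) ∈ F_q[z]^{k×n}. Then C admits a parity-check matrix (i.e., there exists a full-rank H(z) ∈ F_q[z]^{(n−k)×n} with C = { v(z) ∈ F_q[z]^n : H(z)·v(z)^⊤ = 0 }) if and only if G(z) is left prime, i.e., the matrix G(λ) obtained by evaluating every entry of G(z) at λ has rank k for every λ in the algebraic closure of F_q. -/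
open Finset Polynomial Matrix

noncomputable section

variable {F : Type*} [Field F] [DecidableEq F]

set_option linter.unusedSectionVars false

/-- The codewords are the vectors `u G`. -/
theorem IsGenMat.mem_iff_exists_vecMul {ι : Type*} {k : ℕ}
    {C : Submodule F[X] (ι → F[X])} {G : Matrix (Fin k) ι F[X]} (hG : IsGenMat C G)
    {v : ι → F[X]} : v ∈ C ↔ ∃ u, u ᵥ* G = v := by
  rw [← hG.2, Submodule.mem_span_range_iff_exists_fun]
  simp only [vecMul_eq_sum]

/-- If `G(λ)` has full row rank at every `λ`, then an irreducible common factor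
of the entries of `u G` is a common factor of the entries of `u`. -/
theorem dvd_of_forall_dvd_vecMul {n k : ℕ} {G : Matrix (Fin k) (Fin n) F[X]}
    (hrank : ∀ lam : AlgebraicClosure F, (G.map fun p => aeval lam p).rank = k)
    {p : F[X]} (hp : Irreducible p) {u : Fin k → F[X]} (hu : ∀ j, p ∣ (u ᵥ* G) j) (i : Fin k) :
    p ∣ u i := by
  obtain ⟨lam, hlam⟩ := IsAlgClosed.exists_aeval_eq_zero (AlgebraicClosure F) p
    (degree_pos_of_irreducible hp).ne'
  have hli : LinearIndependent (AlgebraicClosure F) (G.map fun p => aeval lam p).row := by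
    rw [linearIndependent_iff_card_eq_finrank_span, Set.finrank, ← rank_eq_finrank_span_row,
      hrank lam, Fintype.card_fin]
  have hzero : (fun i => aeval lam (u i)) = 0 := by
    refine vecMul_injective_iff.2 hli ?_
    ext j
    obtain ⟨c, hc⟩ := hu j
    have := congrArg (aeval lam) hc
    simpa [vecMul, dotProduct, map_sum, hlam] using this
  have hassoc : Associated (minpoly F lam) p :=
    (minpoly.irreducible (Algebra.IsIntegral.isIntegral lam)).associated_of_dvd hp
      (minpoly.dvd F lam hlam)
  exact hassoc.dvd_iff_dvd_left.1 (minpoly.dvd F lam (congrFun hzero i))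

/-- A code with a left prime generator matrix is saturated. -/
theorem IsGenMat.mem_of_smul_mem {n k : ℕ} {C : Submodule F[X] (Fin n → F[X])}
    {G : Matrix (Fin k) (Fin n) F[X]} (hG : IsGenMat C G)
    (hrank : ∀ lam : AlgebraicClosure F, (G.map fun p => aeval lam p).rank = k)
    {p : F[X]} (hp : p ≠ 0) {v : Fin n → F[X]} (hv : p • v ∈ C) : v ∈ C := by
  induction p using UniqueFactorizationMonoid.induction_on_prime generalizing v with
  | h₁ => exact absurd rfl hp
  | h₂ x hx => exact (Submodule.smul_mem_iff_of_isUnit C hx).1 hv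
  | h₃ a p ha hpp ih =>
    refine ih ha ?_
    rw [mul_smul] at hv
    obtain ⟨u, hu⟩ := hG.mem_iff_exists_vecMul.1 hv
    have hdvd := dvd_of_forall_dvd_vecMul hrank hpp.irreducible (u := u) fun j => by
      rw [hu]
      exact ⟨_, rfl⟩
    choose w hw using hdvd
    have huw : u = p • w := funext hw
    rw [huw, smul_vecMul] at hu
    exact hG.mem_iff_exists_vecMul.2 ⟨w, smul_right_injective _ hpp.ne_zero hu⟩

/-- A generator matrix of a code with torsion-free quotient has a right inverse. -/
theorem IsGenMat.exists_mul_eq_one {n k : ℕ} {C : Submodule F[X] (Fin n → F[X])}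
    {G : Matrix (Fin k) (Fin n) F[X]} (hG : IsGenMat C G)
    [Module.IsTorsionFree F[X] ((Fin n → F[X]) ⧸ C)] :
    ∃ M : Matrix (Fin n) (Fin k) F[X], G * M = 1 := by
  have hexact : Function.Exact G.vecMulLinear C.mkQ := fun v => by
    rw [Submodule.mkQ_apply, Submodule.Quotient.mk_eq_zero, hG.mem_iff_exists_vecMul]
    rfl
  obtain ⟨s, hs⟩ := Module.projective_lifting_property C.mkQ LinearMap.id C.mkQ_surjective
  have hinj : Function.Injective G.vecMulLinear := vecMul_injective_iff.2 hG.1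
  have hsplit : (Function.Injective G.vecMulLinear ∧ ∃ s, C.mkQ ∘ₗ s = LinearMap.id) ↔
      Function.Surjective C.mkQ ∧ ∃ l, l ∘ₗ G.vecMulLinear = LinearMap.id :=
    hexact.split_tfae'.out 0 1
  obtain ⟨-, l, hl⟩ := hsplit.1 ⟨hinj, s, hs⟩
  refine ⟨LinearMap.toMatrixRight' l, ?_⟩
  have := congrArg LinearMap.toMatrixRight' hl
  rw [LinearMap.toMatrixRight'_comp, LinearMap.toMatrixRight'_id] at this
  rwa [show G.vecMulLinear = toLinearMapRight' G from rfl,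
    LinearMap.toMatrixRight'.apply_symm_apply] at this

/-- **Parity-check characterization of non-catastrophic convolutional codes.**
An `(n,k)` convolutional code `C` with generator matrix `G(z)` admits a parity-check matrix
iff `G(z)` is left prime, i.e. `G(λ)` has rank `k` for every `λ` in the algebraic closure
of `F_q`. -/
theorem stmt_19 (n k : ℕ) (hkn : k ≤ n)
    (C : Submodule (Polynomial F) (Fin n → Polynomial F))
    (G : Matrix (Fin k) (Fin n) (Polynomial F))
    (hG : IsGenMat C G) :
    (∃ H : Matrix (Fin (n - k)) (Fin n) (Polynomial F),
        LinearIndependent (Polynomial F) (fun i => H i) ∧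
        ∀ v, v ∈ C ↔ H.mulVec v = 0) ↔
    (∀ lam : AlgebraicClosure F,
        (G.map fun p => Polynomial.aeval lam p).rank = k) := by
  constructor
  · rintro ⟨H, -, hH⟩ lam
    have hker : C = LinearMap.ker H.mulVecLin := by
      ext v
      simp [hH]
    have : Module.IsTorsionFree F[X] ((Fin n → F[X]) ⧸ C) := by
      subst hker
      exact H.mulVecLin.quotKerEquivRange.injective.moduleIsTorsionFree _ (map_smul _)
    obtain ⟨M, hM⟩ := hG.exists_mul_eq_one
    have hone : (G.map (aeval lam)) * (M.map (aeval lam)) = 1 := by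
      rw [← Matrix.map_mul, hM, Matrix.map_one _ (map_zero _) (map_one _)]
    refine le_antisymm (rank_le_height _) ?_
    have := rank_mul_le_left (G.map (aeval lam)) (M.map (aeval lam))
    rw [hone, rank_one, Fintype.card_fin] at this
    exact this
  · intro hrank
    have : Module.IsTorsionFree F[X] ((Fin n → F[X]) ⧸ C) := by
      rw [Module.isTorsionFree_iff_smul_eq_zero]
      intro p x hpx
      obtain ⟨v, rfl⟩ := C.mkQ_surjective x
      refine or_iff_not_imp_left.2 fun hp => ?_
      rw [← map_smul] at hpx
      simp only [Submodule.mkQ_apply, Submodule.Quotient.mk_eq_zero] at hpx ⊢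
      exact hG.mem_of_smul_mem hrank hp hpx
    have hfin : Module.finrank F[X] ((Fin n → F[X]) ⧸ C) = n - k := by
      have hC : Module.finrank F[X] C = k := by
        rw [← hG.2, finrank_span_eq_card hG.1, Fintype.card_fin]
      have hsum := C.finrank_quotient_add_finrank
      rw [hC, Module.finrank_fin_fun] at hsum
      omega
    let b := Module.finBasisOfFinrankEq F[X] ((Fin n → F[X]) ⧸ C) hfin
    let h : (Fin n → F[X]) →ₗ[F[X]] (Fin (n - k) → F[X]) := b.equivFun.toLinearMap ∘ₗ C.mkQ
    have hmul (v) : (LinearMap.toMatrix' h) *ᵥ v = h v := LinearMap.toMatrix'_mulVec h v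
    refine ⟨LinearMap.toMatrix' h, ?_, fun v => ?_⟩
    · have hsurj : Function.Surjective h := b.equivFun.surjective.comp C.mkQ_surjective
      refine vecMul_injective_iff.1 ?_
      rw [← coe_vecMulLinear, ← LinearMap.ker_eq_bot, LinearMap.ker_eq_bot']
      intro u hu
      refine dotProduct_eq_zero _ fun w => ?_
      obtain ⟨v, rfl⟩ := hsurj w
      rw [← hmul, dotProduct_mulVec]
      simp_all
    · rw [hmul]
      simp [h]
end
end
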